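/- arXiv:1805.06732 — 2 statements merged into one kernel-verified Lean document; each statement's English description precedes it below -/
import Mathlib

section
/- If X is an analytic (separable metrizable) space, then F₀(X), the set of all closed zero-dimensional subsets of X, is a Σ¹₂ subset of F(X) with respect to any admissible topology. -/
open Set Filter Topology TopologicalSpace

/-- `DimLE X n` : the topological (covering) dimension of `X` is at most `n`, i.e. every
finite open cover of `X` admits an open shrinking (refinement) of order at most `n + 1`. -/
def DimLE (X : Type*) [TopologicalSpace X] (n : ℕ) : Prop :=
  ∀ (k : ℕ) (U : Fin k → Set X), (∀ i, IsOpen (U i)) → (⋃ i, U i) = Set.univ →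
    ∃ V : Fin k → Set X, (∀ i, IsOpen (V i)) ∧ (∀ i, V i ⊆ U i) ∧ (⋃ i, V i) = Set.univ ∧
      ∀ x : X, ({i | x ∈ V i}).ncard ≤ n + 1

/-- The collection `F(X)` of closed subsets of `X`. -/
abbrev Cl (X : Type*) [TopologicalSpace X] : Type _ := {F : Set X // IsClosed F}

/-- `F₀(X)` : the set of all closed zero-dimensional subsets of `X`. -/
def F0 (X : Type*) [TopologicalSpace X] : Set (Cl X) := {F | DimLE (↥F.1) 0}

/-- The Vietoris topology on subsets of `Y`. -/
def vietoris (Y : Type*) [TopologicalSpace Y] : TopologicalSpace (Set Y) :=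
  TopologicalSpace.generateFrom
    ({S | ∃ U : Set Y, IsOpen U ∧ S = {A : Set Y | A ⊆ U}} ∪
     {S | ∃ U : Set Y, IsOpen U ∧ S = {A : Set Y | (A ∩ U).Nonempty}})

/-- A topology `τ` on `F(X)` is admissible if it is induced, via `F ↦ closure (e '' F)`,
by the Vietoris topology on some metrizable compactification `Y` of `X` (with embedding `e`). -/
def IsAdmissible (X : Type*) [tX : TopologicalSpace X] (τ : TopologicalSpace (Cl X)) : Prop :=
  ∃ (Y : Type) (tY : TopologicalSpace Y) (_ : @CompactSpace Y tY)
    (_ : @TopologicalSpace.MetrizableSpace Y tY) (e : X → Y),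
      @Topology.IsEmbedding X Y tX tY e ∧
      τ = (@vietoris Y tY).induced (fun F : Cl X => @closure Y tY (e '' F.1))

/-- An analytic space: a separable metrizable space which is empty or a continuous image
of the Baire space `ℕ → ℕ`. -/
def IsAnalyticSpace (X : Type*) [TopologicalSpace X] : Prop :=
  TopologicalSpace.MetrizableSpace X ∧ TopologicalSpace.SeparableSpace X ∧
    (IsEmpty X ∨ ∃ f : (ℕ → ℕ) → X, Continuous f ∧ Function.Surjective f)

/-- `Σ¹₂` subsets of a topological space: projections of co-analytic sets. -/
def IsSigma12 {W : Type*} [TopologicalSpace W] (s : Set W) : Prop :=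
  ∃ B : Set (W × (ℕ → ℕ)), MeasureTheory.AnalyticSet Bᶜ ∧ s = {w | ∃ y, (w, y) ∈ B}

/-- `Σ¹₂`-hardness (with Cantor space `2^ω = ℕ → Bool` as source). -/
def Sigma12Hard {W : Type*} [TopologicalSpace W] (A : Set W) : Prop :=
  ∀ A' : Set (ℕ → Bool), IsSigma12 A' →
    ∃ φ : (ℕ → Bool) → W, Continuous φ ∧ A' = φ ⁻¹' A

/-- `Π¹₁`-hardness. -/
def Pi11Hard {W : Type*} [TopologicalSpace W] (A : Set W) : Prop :=
  ∀ A' : Set (ℕ → Bool), MeasureTheory.AnalyticSet A'ᶜ →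
    ∃ φ : (ℕ → Bool) → W, Continuous φ ∧ A' = φ ⁻¹' A

/-- The additive Borel classes `Σ⁰ξ` : `Σ⁰₁` consists of the open sets, and for `ξ > 1`,
`Σ⁰ξ` consists of countable unions of sets whose complements are in some `Σ⁰η`, `η < ξ`. -/
inductive SigmaOrd {W : Type*} [TopologicalSpace W] : Ordinal.{0} → Set W → Prop
  | basic (s : Set W) : IsOpen s → SigmaOrd 1 s
  | union (ξ : Ordinal.{0}) (η : ℕ → Ordinal.{0}) (f : ℕ → Set W) (hξ : 1 < ξ)
      (hη : ∀ n, η n < ξ) (h : ∀ n, SigmaOrd (η n) (f n)ᶜ) : SigmaOrd ξ (⋃ n, f n)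

/-- The run produced when player I follows the strategy `σ` and player II plays `β`. -/
def playI (σ : List ℕ → ℕ) (β : ℕ → ℕ) : ℕ → ℕ := fun n =>
  if n % 2 = 0 then σ (List.ofFn fun i : Fin (n / 2) => β i) else β (n / 2)

/-- Player I has a winning strategy in the game `G_A`. -/
def PlayerIWins (A : Set (ℕ → ℕ)) : Prop :=
  ∃ σ : List ℕ → ℕ, ∀ β : ℕ → ℕ, playI σ β ∈ A

/-- The game operator `Game B` applied to `B ⊆ W × ω^ω`. -/
def GameOp {W : Type*} (B : Set (W × (ℕ → ℕ))) : Set W :=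
  {w | PlayerIWins {γ | (w, γ) ∈ B}}

/-- `Game Σ⁰ξ`-hardness. -/
def GameSigmaHard (ξ : Ordinal.{0}) {W : Type*} [TopologicalSpace W] (A : Set W) : Prop :=
  ∀ A' : Set (ℕ → Bool),
    (∃ B : Set ((ℕ → Bool) × (ℕ → ℕ)), SigmaOrd ξ B ∧ A' = GameOp B) →
    ∃ φ : (ℕ → Bool) → W, Continuous φ ∧ A' = φ ⁻¹' A

/-- In a space of covering dimension zero, clopen sets separate a closed set from the complement
of an open neighbourhood of it. -/
theorem DimLE.exists_isClopen_between {T : Type*} [TopologicalSpace T] (h : DimLE T 0)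
    {A U : Set T} (hA : IsClosed A) (hU : IsOpen U) (hAU : A ⊆ U) :
    ∃ V : Set T, IsClopen V ∧ A ⊆ V ∧ V ⊆ U := by
  obtain ⟨V, hVo, hVU, hVc, hV⟩ := h 2 ![U, Aᶜ]
    (by simp [Fin.forall_fin_two, hU, hA.isOpen_compl]) (by
      refine eq_univ_of_forall fun x => mem_iUnion.2 ?_
      by_cases hx : x ∈ A
      · exact ⟨0, hAU hx⟩
      · exact ⟨1, hx⟩)
  have hcov : ∀ x, x ∈ V 0 ∨ x ∈ V 1 := fun x => by
    simpa [Fin.exists_fin_two] using (hVc ▸ mem_univ x : x ∈ ⋃ i, V i)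
  have hdisj : ∀ x, x ∈ V 0 → x ∉ V 1 := fun x h0 h1 =>
    zero_ne_one ((Set.ncard_le_one (Set.toFinite _)).1 (hV x) 0 h0 1 h1)
  have hcompl : (V 0)ᶜ = V 1 := by
    ext x
    exact ⟨(hcov x).resolve_left, fun h1 h0 => hdisj x h0 h1⟩
  refine ⟨V 0, ⟨⟨hcompl ▸ hVo 1⟩, hVo 0⟩, fun x hx => ?_, hVU 0⟩
  exact (hcov x).resolve_right fun h1 => hVU 1 h1 hx

/-- A second countable space with a basis of clopen sets has covering dimension zero. -/
theorem DimLE.of_exists_isClopen {T : Type*} [TopologicalSpace T] [SecondCountableTopology T]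
    (h : ∀ (x : T) (U : Set T), IsOpen U → x ∈ U → ∃ V : Set T, IsClopen V ∧ x ∈ V ∧ V ⊆ U) :
    DimLE T 0 := by
  classical
  intro k U hU hUc
  rcases isEmpty_or_nonempty T with hT | hT
  · exact ⟨U, hU, fun _ => Subset.rfl, hUc, fun x => hT.elim x⟩
  have hmem : ∀ x : T, ∃ i, x ∈ U i := fun x => mem_iUnion.1 (hUc ▸ mem_univ x)
  choose i hi using hmem
  choose C hC hxC hCU using fun x => h x (U (i x)) (hU _) (hi x)
  obtain ⟨s, hs, hsC⟩ := TopologicalSpace.countable_cover_nhds fun x => (hC x).isOpen.mem_nhds (hxC x)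
  have hsne : s.Nonempty := by
    by_contra! hs0
    exact empty_ne_univ (by simpa [hs0] using hsC)
  obtain ⟨c, rfl⟩ := hs.exists_eq_range hsne
  have H : ∀ x : T, ∃ n, x ∈ C (c n) := fun x => by
    simpa using (hsC ▸ mem_univ x : x ∈ ⋃ y ∈ range c, C y)
  have hN : Continuous fun x => Nat.find (H x) := by
    refine continuous_discrete_rng.2 fun n => ?_
    rw [preimage_find_eq_disjointed (fun n => C (c n)) H n]
    refine disjointedRec (p := IsOpen) (fun t m ht => ht.sdiff (hC _).isClosed) (hC _).isOpen
  refine ⟨fun j => (fun x => Nat.find (H x)) ⁻¹' {n | i (c n) = j},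
    fun j => (isOpen_discrete _).preimage hN, ?_, ?_, fun x => ?_⟩
  · rintro j x rfl
    exact hCU _ (Nat.find_spec (H x))
  · exact eq_univ_of_forall fun x => mem_iUnion.2 ⟨_, rfl⟩
  · have : {j | x ∈ (fun x => Nat.find (H x)) ⁻¹' {n | i (c n) = j}}
        = {i (c (Nat.find (H x)))} := by
      ext j
      simp [eq_comm]
    rw [this, ncard_singleton]

/-- The open set coded by `y`: the union of those `b k` for which `y` takes the value `m` at
the code of `(i, j, k)`. -/
def codedOpen {X : Type*} (b : ℕ → Set X) (m i j : ℕ) (y : ℕ → ℕ) : Set X :=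
  ⋃ k ∈ {k | y (Nat.pair (Nat.pair i j) k) = m}, b k

/-- At the point `x`, the two open sets coded by `y` for the pair `(i, j)` look like a partition
separating `b i` from the complement of `b j`. -/
def CodesSeparationAt {X : Type*} (b : ℕ → Set X) (i j : ℕ) (y : ℕ → ℕ) (x : X) : Prop :=
  (x ∈ codedOpen b 1 i j y ∧ x ∉ codedOpen b 2 i j y ∧ x ∈ b j) ∨
    (x ∈ codedOpen b 2 i j y ∧ x ∉ codedOpen b 1 i j y ∧ x ∉ b i)

theorem mem_codedOpen {X : Type*} {b : ℕ → Set X} {m i j : ℕ} {y : ℕ → ℕ} {x : X} :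
    x ∈ codedOpen b m i j y ↔ ∃ k, y (Nat.pair (Nat.pair i j) k) = m ∧ x ∈ b k := by
  simp [codedOpen]

theorem isOpen_codedOpen {X : Type*} [TopologicalSpace X] {b : ℕ → Set X}
    (hb : ∀ k, IsOpen (b k)) (m i j : ℕ) (y : ℕ → ℕ) : IsOpen (codedOpen b m i j y) :=
  isOpen_biUnion fun k _ => hb k

theorem measurableSet_codesSeparationAt {X Z : Type*} [TopologicalSpace X] {b : ℕ → Set X}
    (hb : ∀ k, IsOpen (b k)) [TopologicalSpace Z] [MeasurableSpace Z] [OpensMeasurableSpace Z]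
    {f : Z → X} (hf : Continuous f) (i j : ℕ) :
    MeasurableSet {p : (ℕ → ℕ) × Z | CodesSeparationAt b i j p.1 (f p.2)} := by
  have hbk : ∀ k, MeasurableSet {p : (ℕ → ℕ) × Z | f p.2 ∈ b k} := fun k =>
    measurable_snd ((hb k).preimage hf).measurableSet
  have hG : ∀ m, MeasurableSet {p : (ℕ → ℕ) × Z | f p.2 ∈ codedOpen b m i j p.1} := fun m => by
    simp only [mem_codedOpen]
    refine .congr (.iUnion fun k => (((measurable_pi_apply (Nat.pair (Nat.pair i j) k)).comp
      measurable_fst) (measurableSet_singleton m)).inter (hbk k)) ?_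
    ext p
    simp
  exact ((hG 1).inter ((hG 2).compl.inter (hbk j))).union
    ((hG 2).inter ((hG 1).compl.inter (hbk i).compl))

/-- A subspace of a second countable regular space is zero-dimensional if and only if some
`y : ℕ → ℕ` codes separations of all pairs of basic open sets one of which contains the closure
of the other. -/
theorem dimLE_zero_iff_exists_code {X : Type*} [TopologicalSpace X] [RegularSpace X]
    {b : ℕ → Set X} (hb : IsTopologicalBasis (range b)) (F : Set X) :
    DimLE F 0 ↔ ∃ y : ℕ → ℕ, ∀ x ∈ F, ∀ i j, closure (b i) ⊆ b j →
      CodesSeparationAt b i j y x := by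
  classical
  have hbo : ∀ k, IsOpen (b k) := fun k => hb.isOpen (mem_range_self k)
  have hsc : SecondCountableTopology X := hb.secondCountableTopology (countable_range b)
  constructor
  · intro h
    have hsep : ∀ i j, ∃ V : Set F, IsClopen V ∧ (closure (b i) ⊆ b j →
        (↑) ⁻¹' closure (b i) ⊆ V ∧ V ⊆ (↑) ⁻¹' b j) := by
      intro i j
      by_cases hij : closure (b i) ⊆ b j
      · obtain ⟨V, hV, h1, h2⟩ := h.exists_isClopen_between
          (isClosed_closure.preimage continuous_subtype_val)
          ((hbo j).preimage continuous_subtype_val) (preimage_mono hij)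
        exact ⟨V, hV, fun _ => ⟨h1, h2⟩⟩
      · exact ⟨∅, isClopen_empty, fun h => absurd h hij⟩
    choose V hV hVij using hsep
    let y : ℕ → ℕ := fun n =>
      if (↑) ⁻¹' b n.unpair.2 ⊆ V n.unpair.1.unpair.1 n.unpair.1.unpair.2 then 1
      else if (↑) ⁻¹' b n.unpair.2 ⊆ (V n.unpair.1.unpair.1 n.unpair.1.unpair.2)ᶜ then 2 else 0
    have hy : ∀ i j k, y (Nat.pair (Nat.pair i j) k) =
        if ((↑) ⁻¹' b k : Set F) ⊆ V i j then 1
        else if ((↑) ⁻¹' b k : Set F) ⊆ (V i j)ᶜ then 2 else 0 := by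
      intro i j k
      simp [y]
    have hbasic : ∀ {W : Set F} {x : F}, IsOpen W → x ∈ W →
        ∃ k, (x : X) ∈ b k ∧ ((↑) ⁻¹' b k : Set F) ⊆ W := by
      rintro W x hW hx
      obtain ⟨O, hO, rfl⟩ := isOpen_induced_iff.1 hW
      obtain ⟨_, ⟨k, rfl⟩, hk, hkO⟩ := hb.exists_subset_of_mem_open hx hO
      exact ⟨k, hk, preimage_mono hkO⟩
    have h1 : ∀ i j (x : F), (x : X) ∈ codedOpen b 1 i j y ↔ x ∈ V i j := by
      intro i j x
      rw [mem_codedOpen]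
      constructor
      · rintro ⟨k, hk, hxk⟩
        rw [hy] at hk
        by_contra hx
        rw [if_neg fun h => hx (h hxk)] at hk
        split_ifs at hk; simp at hk
      · intro hx
        obtain ⟨k, hk, hkV⟩ := hbasic (hV i j).isOpen hx
        exact ⟨k, by rw [hy, if_pos hkV], hk⟩
    have h2 : ∀ i j (x : F), (x : X) ∈ codedOpen b 2 i j y ↔ x ∉ V i j := by
      intro i j x
      rw [mem_codedOpen]
      constructor
      · rintro ⟨k, hk, hxk⟩
        rw [hy] at hk
        intro hx
        rw [if_neg (c := _ ⊆ (V i j)ᶜ) fun h => h hxk hx] at hk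
        split_ifs at hk; simp at hk
      · intro hx
        obtain ⟨k, hk, hkV⟩ := hbasic (hV i j).compl.isOpen hx
        exact ⟨k, by rw [hy, if_neg fun h => hx (h hk), if_pos hkV], hk⟩
    refine ⟨y, fun x hx i j hij => ?_⟩
    obtain ⟨hiV, hVj⟩ := hVij i j hij
    have e1 := h1 i j ⟨x, hx⟩
    have e2 := h2 i j ⟨x, hx⟩
    unfold CodesSeparationAt
    by_cases hxV : (⟨x, hx⟩ : F) ∈ V i j
    · exact .inl ⟨e1.2 hxV, fun h => e2.1 h hxV, hVj hxV⟩
    · exact .inr ⟨e2.2 hxV, fun h => hxV (e1.1 h), fun h => hxV (hiV (subset_closure h))⟩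
  · rintro ⟨y, hy⟩
    refine DimLE.of_exists_isClopen fun x U hU hx => ?_
    obtain ⟨O, hO, rfl⟩ := isOpen_induced_iff.1 hU
    obtain ⟨_, ⟨j, rfl⟩, hxj, hjO⟩ := hb.exists_subset_of_mem_open hx hO
    obtain ⟨_, ⟨i, rfl⟩, hxi, hij⟩ :=
      hb.exists_closure_subset ((hbo j).mem_nhds hxj)
    have hsep := fun z : F => hy z z.2 i j hij
    have hcompl : ((↑) ⁻¹' codedOpen b 1 i j y : Set F)ᶜ = (↑) ⁻¹' codedOpen b 2 i j y := by
      ext z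
      rcases hsep z with h | h <;> simp [h.1, h.2.1]
    refine ⟨(↑) ⁻¹' codedOpen b 1 i j y, ⟨⟨?_⟩, ?_⟩, ?_, fun z hz => ?_⟩
    · exact hcompl ▸ (isOpen_codedOpen hbo 2 i j y).preimage continuous_subtype_val
    · exact (isOpen_codedOpen hbo 1 i j y).preimage continuous_subtype_val
    · exact (hsep x).elim (fun h => h.1) fun h => absurd hxi h.2.2
    · exact hjO ((hsep z).elim (fun h => h.2.2) fun h => absurd hz h.2.1)

/-- The Vietoris topology induces a second countable topology on any family of closed subsets of
a second countable compact space. -/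
theorem secondCountableTopology_induced_vietoris {Y W : Type*} [TopologicalSpace Y]
    [CompactSpace Y] [SecondCountableTopology Y] {c : W → Set Y} (hc : ∀ w, IsClosed (c w)) :
    @SecondCountableTopology W ((_root_.vietoris Y).induced c) := by
  have hV : _root_.vietoris Y = TopologicalSpace.vietoris Y := by
    unfold _root_.vietoris TopologicalSpace.vietoris
    congr 1
    ext S
    simp [powerset, eq_comm]
  let d : W → Compacts Y := fun w => ⟨c w, (hc w).isCompact⟩
  have : (_root_.vietoris Y).induced c = (inferInstance : TopologicalSpace (Compacts Y)).induced d := by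
    let := TopologicalSpace.vietoris Y
    rw [(Compacts.isEmbedding_coe (α := Y)).eq_induced, induced_compose, hV]
    rfl
  rw [this]
  exact secondCountableTopology_induced _ _ _

/-- Measurability with respect to the Vietoris topology, tested on the subbasis. -/
theorem measurable_induced_vietoris {Y W Ω : Type*} [TopologicalSpace Y]
    [CompactSpace Y] [SecondCountableTopology Y] {c : W → Set Y} (hc : ∀ w, IsClosed (c w))
    [MeasurableSpace Ω] {φ : Ω → W}
    (hsub : ∀ U, IsOpen U → MeasurableSet {ω | c (φ ω) ⊆ U})
    (hmeet : ∀ U, IsOpen U → MeasurableSet {ω | (c (φ ω) ∩ U).Nonempty}) :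
    @Measurable Ω W _ (@borel W ((_root_.vietoris Y).induced c)) φ := by
  let := (_root_.vietoris Y).induced c
  have := secondCountableTopology_induced_vietoris hc
  have hborel := borel_eq_generateFrom_of_subbasis
    (α := W) (induced_generateFrom_eq : (_root_.vietoris Y).induced c = _)
  refine hborel ▸ measurable_generateFrom ?_
  rintro _ ⟨_, ⟨U, hU, rfl⟩ | ⟨U, hU, rfl⟩, rfl⟩
  · exact hsub U hU
  · exact hmeet U hU

theorem measurableSet_closure_range_subset {Y Ω : Type*} [TopologicalSpace Y] [CompactSpace Y]
    [MetrizableSpace Y] [MeasurableSpace Ω] {g : ℕ → Ω → Y}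
    (hg : ∀ n U, IsOpen U → MeasurableSet (g n ⁻¹' U)) {U : Set Y} (hU : IsOpen U) :
    MeasurableSet {ω | closure (range fun n => g n ω) ⊆ U} := by
  let := metrizableSpaceMetric Y
  have : {ω | closure (range fun n => g n ω) ⊆ U} =
      ⋃ m : ℕ, ⋂ n, (g n ⁻¹' Metric.thickening (1 / (m + 1)) Uᶜ)ᶜ := by
    ext ω
    simp only [mem_ofPred_eq, mem_iUnion, mem_iInter, mem_compl_iff, mem_preimage]
    constructor
    · intro h
      obtain ⟨δ, hδ, hδU⟩ := isClosed_closure.isCompact.exists_thickening_subset_open hU h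
      obtain ⟨m, hm⟩ := exists_nat_one_div_lt hδ
      refine ⟨m, fun n hn => ?_⟩
      obtain ⟨u, hu, hdist⟩ := Metric.mem_thickening_iff.1 hn
      refine hu (hδU (Metric.mem_thickening_iff.2
        ⟨g n ω, subset_closure (mem_range_self n), ?_⟩))
      rw [dist_comm]
      exact hdist.trans hm
    · rintro ⟨m, hm⟩ x hx
      have hx' : x ∈ (Metric.thickening (1 / ((m : ℝ) + 1)) Uᶜ)ᶜ :=
        closure_minimal (range_subset_iff.2 hm) Metric.isOpen_thickening.isClosed_compl hx
      by_contra hxU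
      exact hx' (Metric.self_subset_thickening (by positivity) _ hxU)
  rw [this]
  exact .iUnion fun m => .iInter fun n => (hg n _ Metric.isOpen_thickening).compl

theorem measurableSet_closure_range_inter_nonempty {Y Ω : Type*} [TopologicalSpace Y]
    [MeasurableSpace Ω] {g : ℕ → Ω → Y}
    (hg : ∀ n U, IsOpen U → MeasurableSet (g n ⁻¹' U)) {U : Set Y} (hU : IsOpen U) :
    MeasurableSet {ω | (closure (range fun n => g n ω) ∩ U).Nonempty} := by
  have : {ω | (closure (range fun n => g n ω) ∩ U).Nonempty} = ⋃ n, g n ⁻¹' U := by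
    ext ω
    simp only [mem_ofPred_eq, closure_inter_open_nonempty_iff hU, mem_iUnion, mem_preimage]
    constructor
    · rintro ⟨_, ⟨n, rfl⟩, hn⟩
      exact ⟨n, hn⟩
    · rintro ⟨n, hn⟩
      exact ⟨_, mem_range_self n, hn⟩
  rw [this]
  exact .iUnion fun n => hg n U hU

theorem measurableSet_mem_closure_range {X Ω : Type*} [TopologicalSpace X] [MeasurableSpace Ω]
    {b : ℕ → Set X} (hb : IsTopologicalBasis (range b)) {h : Ω → X} {g : ℕ → Ω → X}
    (hh : ∀ U, IsOpen U → MeasurableSet (h ⁻¹' U))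
    (hg : ∀ n U, IsOpen U → MeasurableSet (g n ⁻¹' U)) :
    MeasurableSet {ω | h ω ∈ closure (range fun n => g n ω)} := by
  have hbo : ∀ k, IsOpen (b k) := fun k => hb.isOpen (mem_range_self k)
  have : {ω | h ω ∈ closure (range fun n => g n ω)} =
      ⋂ k, ((h ⁻¹' b k)ᶜ ∪ ⋃ n, g n ⁻¹' b k) := by
    ext ω
    simp [hb.mem_closure_iff, Set.Nonempty, ← imp_iff_not_or, and_comm]
  rw [this]
  exact .iInter fun k => (hh _ (hbo k)).compl.union (.iUnion fun n => hg n _ (hbo k))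

theorem exists_seq_closure_range_eq {X Z : Type*} [TopologicalSpace X]
    [SecondCountableTopology X] {f : Z → X} (hf : Function.Surjective f) {F : Set X}
    (hF : IsClosed F) (hne : F.Nonempty) : ∃ z : ℕ → Z, closure (range fun n => f (z n)) = F := by
  have : Nonempty F := hne.to_subtype
  obtain ⟨u, hu⟩ := exists_dense_seq F
  choose z hz using fun n => hf (u n)
  refine ⟨z, ?_⟩
  simp only [hz]
  refine (closure_minimal (range_subset_iff.2 fun n => (u n).2) hF).antisymm fun x hx => ?_
  have := image_closure_subset_closure_image continuous_subtype_val
    (mem_image_of_mem _ (hu ⟨x, hx⟩))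
  rwa [← range_comp] at this

/-- If `X` is an analytic space, then `F₀(X)`, the set of all closed zero-dimensional
subsets of `X`, is a `Σ¹₂` subset of `F(X)` with respect to any admissible topology. -/
theorem F0_isSigma12_of_analytic {X : Type*} [TopologicalSpace X] (hX : IsAnalyticSpace X)
    (τ : TopologicalSpace (Cl X)) (hτ : IsAdmissible X τ) :
    @IsSigma12 (Cl X) τ (F0 X) := by
  obtain ⟨hXm, hXs, hXa⟩ := hX
  obtain ⟨Y, tY, hYc, hYm, e, he, rfl⟩ := hτ
  let : UniformSpace X := pseudoMetrizableSpaceUniformity X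
  have := pseudoMetrizableSpaceUniformity_countably_generated X
  have hXsc : SecondCountableTopology X := UniformSpace.secondCountable_of_separable X
  have hYsc : SecondCountableTopology Y := by
    let := metrizableSpaceMetric Y
    infer_instance
  let := (_root_.vietoris Y).induced fun F : Cl X => closure (e '' F.1)
  have hc : ∀ F : Cl X, IsClosed (closure (e '' F.1)) := fun _ => isClosed_closure
  have hWsc : SecondCountableTopology (Cl X) := secondCountableTopology_induced_vietoris hc
  obtain ⟨b, hb⟩ : ∃ b : ℕ → Set X, IsTopologicalBasis (range b) := by
    obtain ⟨b, hb⟩ := ((countable_countableBasis X).insert ∅).exists_eq_range (insert_nonempty _ _)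
    exact ⟨b, hb ▸ (isBasis_countableBasis X).insert_empty⟩
  have hbo : ∀ k, IsOpen (b k) := fun k => hb.isOpen (mem_range_self k)
  refine ⟨{p | ∀ x ∈ p.1.1, ∀ i j, closure (b i) ⊆ b j → CodesSeparationAt b i j p.2 x}, ?_, ?_⟩
  swap
  · ext F
    exact dimLE_zero_iff_exists_code hb F.1
  rcases hXa with hXe | ⟨f, hf, hfs⟩
  · convert! MeasureTheory.analyticSet_empty
    simp
  let φ : (ℕ → ℕ → ℕ) → Cl X := fun z => ⟨closure (range fun n => f (z n)), isClosed_closure⟩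
  have hφ : ∀ z, closure (e '' (φ z).1) = closure (range fun n => e (f (z n))) := fun z => by
    rw [closure_image_closure he.continuous, ← range_comp]
    rfl
  have hef : ∀ n U, IsOpen U →
      MeasurableSet ((fun z : ℕ → ℕ → ℕ => e (f (z n))) ⁻¹' U) := fun n U hU =>
    (hU.preimage (he.continuous.comp (hf.comp (continuous_apply n)))).measurableSet
  let : MeasurableSpace (Cl X) := borel _
  have : BorelSpace (Cl X) := ⟨rfl⟩
  have hφm : Measurable φ := by
    refine measurable_induced_vietoris hc (fun U hU => ?_) fun U hU => ?_
    · simp only [hφ]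
      exact measurableSet_closure_range_subset hef hU
    · simp only [hφ]
      exact measurableSet_closure_range_inter_nonempty hef hU
  let Φ : (ℕ → ℕ → ℕ) × (ℕ → ℕ) × (ℕ → ℕ) → Cl X × (ℕ → ℕ) := fun q => (φ q.1, q.2.1)
  have hΦ : Measurable Φ := (hφm.comp measurable_fst).prodMk measurable_snd.fst
  let S : Set ((ℕ → ℕ → ℕ) × (ℕ → ℕ) × (ℕ → ℕ)) :=
    {q | f q.2.2 ∈ closure (range fun n => f (q.1 n))} ∩
      ⋃ i, ⋃ j, ⋃ _ : closure (b i) ⊆ b j, {q | CodesSeparationAt b i j q.2.1 (f q.2.2)}ᶜ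
  have hS : MeasurableSet S := by
    refine (measurableSet_mem_closure_range hb (fun U hU => ?_) fun n U hU => ?_).inter
      (.iUnion fun i => .iUnion fun j => .iUnion fun _ => ?_)
    · exact measurable_snd.snd (hU.preimage hf).measurableSet
    · have hn : Measurable fun q : (ℕ → ℕ → ℕ) × (ℕ → ℕ) × (ℕ → ℕ) => q.1 n :=
        (measurable_pi_apply n).comp measurable_fst
      exact hn (hU.preimage hf).measurableSet
    · exact (measurable_snd (measurableSet_codesSeparationAt hbo hf i j)).compl
  convert! hS.analyticSet_image hΦ
  ext ⟨F, y⟩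
  simp only [mem_compl_iff, mem_ofPred_eq, not_forall, mem_image]
  constructor
  · rintro ⟨x, hx, i, j, hij, hbad⟩
    obtain ⟨z, hz⟩ := exists_seq_closure_range_eq hfs F.2 ⟨x, hx⟩
    obtain ⟨t, rfl⟩ := hfs x
    refine ⟨(z, y, t), ⟨?_, ?_⟩, Prod.ext (Subtype.ext hz) rfl⟩
    · exact hz.ge hx
    · simp only [mem_iUnion]
      exact ⟨i, j, hij, hbad⟩
  · rintro ⟨⟨z, y, t⟩, ⟨hmem, hbad⟩, hzy⟩
    simp only [mem_iUnion] at hbad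
    obtain ⟨i, j, hij, hbad⟩ := hbad
    obtain ⟨rfl, rfl⟩ := Prod.ext_iff.1 hzy
    exact ⟨f t, hmem, i, j, hij, hbad⟩
end

section
/- For every countable ordinal ξ ≥ 3 there exists a Π⁰_ξ set X ⊂ 2^ω × [0,1] such that F₀(X) is Game Σ⁰_ξ-hard. -/
open Set Filter Topology TopologicalSpace

namespace SigmaOrd

variable {W Z : Type*} [TopologicalSpace W] [TopologicalSpace Z] {ξ η : Ordinal.{0}}

lemma one_le {s : Set W} (h : SigmaOrd ξ s) : 1 ≤ ξ := by
  cases h with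
  | basic _ _ => exact le_rfl
  | union _ η f hξ _ _ => exact hξ.le

lemma isOpen {s : Set W} (h : SigmaOrd 1 s) : IsOpen s := by
  cases h with
  | basic _ h => exact h
  | union _ η f hξ _ _ => exact absurd hξ (lt_irrefl _)

lemma exists_iUnion {s : Set W} (h : SigmaOrd ξ s) (hξ : 1 < ξ) :
    ∃ (η : ℕ → Ordinal.{0}) (f : ℕ → Set W), (∀ n, η n < ξ) ∧
      (∀ n, SigmaOrd (η n) (f n)ᶜ) ∧ s = ⋃ n, f n := by
  cases h with
  | basic _ h => exact absurd hξ (lt_irrefl _)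
  | union _ η f _ hη h => exact ⟨η, f, hη, h, rfl⟩

lemma preimage {s : Set W} (h : SigmaOrd ξ s) {f : Z → W} (hf : Continuous f) :
    SigmaOrd ξ (f ⁻¹' s) := by
  induction h with
  | basic s hs => exact .basic _ (hs.preimage hf)
  | union ξ η g hξ hη _ ih =>
    rw [preimage_iUnion]
    exact .union ξ η _ hξ hη ih

/-- The preimage under a continuous map defined on a subset is a trace. -/
lemma exists_preimage {s : Set W} (h : SigmaOrd ξ s) {P : Set Z} {f : P → W}
    (hf : Continuous f) : ∃ s' : Set Z, SigmaOrd ξ s' ∧ ∀ x : P, x.1 ∈ s' ↔ f x ∈ s := by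
  induction h with
  | basic s hs =>
    obtain ⟨t, ht, hts⟩ := isOpen_induced_iff.1 (hs.preimage hf)
    exact ⟨t, .basic _ ht, fun x => by
      rw [← mem_preimage (f := f), ← hts]; rfl⟩
  | union ξ η g hξ hη _ ih =>
    choose t ht hts using ih
    refine ⟨⋃ n, (t n)ᶜ, .union ξ η _ hξ hη (by simpa using ht), fun x => ?_⟩
    simp only [mem_iUnion, mem_compl_iff, hts, not_not]

lemma of_compl {s : Set W} (h : SigmaOrd η sᶜ) (hη : η < ξ) : SigmaOrd ξ s := by
  have := SigmaOrd.union ξ (fun _ => η) (fun _ => s) (h.one_le.trans_lt hη) (fun _ => hη)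
    (fun _ => h)
  simpa [iUnion_const] using this

lemma iUnion {s : ℕ → Set W} (h : ∀ n, SigmaOrd ξ (s n)) : SigmaOrd ξ (⋃ n, s n) := by
  rcases (h 0).one_le.eq_or_lt with rfl | hξ
  · exact .basic _ (isOpen_iUnion fun n => (h n).isOpen)
  · choose η f hη hf hs using fun n => (h n).exists_iUnion hξ
    have : ⋃ n, s n = ⋃ k : ℕ, f k.unpair.1 k.unpair.2 := by
      ext x
      simp only [hs, mem_iUnion]
      constructor
      · rintro ⟨n, m, hx⟩
        exact ⟨Nat.pair n m, by simpa using hx⟩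
      · rintro ⟨k, hx⟩
        exact ⟨_, _, hx⟩
    rw [this]
    exact .union ξ (fun k => η k.unpair.1 k.unpair.2) _ hξ (fun _ => hη _ _) (fun _ => hf _ _)

lemma union' {s t : Set W} (hs : SigmaOrd ξ s) (ht : SigmaOrd ξ t) : SigmaOrd ξ (s ∪ t) := by
  have : s ∪ t = ⋃ n : ℕ, if n = 0 then s else t := by
    ext x
    simp only [mem_iUnion, mem_union]
    constructor
    · rintro (h | h)
      · exact ⟨0, by simpa⟩
      · exact ⟨1, by simpa⟩
    · rintro ⟨n, hn⟩
      split_ifs at hn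
      · exact .inl hn
      · exact .inr hn
  rw [this]
  refine iUnion fun n => ?_
  split_ifs
  exacts [hs, ht]

lemma univ (hξ : 1 ≤ ξ) : SigmaOrd ξ (univ : Set W) := by
  rcases hξ.eq_or_lt with rfl | hξ
  · exact .basic _ isOpen_univ
  · exact of_compl (.basic _ (by simp)) hξ

lemma of_isClosed {s : Set W} (h : IsClosed s) (hξ : 2 ≤ ξ) : SigmaOrd ξ s :=
  of_compl (basic _ h.isOpen_compl) (lt_of_lt_of_le (by norm_num) hξ)

lemma of_isGδ {s : Set W} (h : IsGδ s) (hξ : 3 ≤ ξ) : SigmaOrd ξ s := by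
  obtain ⟨f, hf, rfl⟩ := isGδ_iff_eq_iInter_nat.1 h
  refine of_compl (η := 2) ?_ (lt_of_lt_of_le (by norm_num) hξ)
  rw [compl_iInter]
  exact iUnion fun n => of_isClosed (hf n).isClosed_compl le_rfl

variable [PseudoMetrizableSpace W]

lemma mono {s : Set W} (h : SigmaOrd η s) (hη : η ≤ ξ) : SigmaOrd ξ s := by
  rcases hη.eq_or_lt with rfl | hlt
  · exact h
  cases h with
  | basic _ h =>
    let := pseudoMetrizableSpacePseudoMetric W
    obtain ⟨F, hF, -, rfl, -⟩ := h.exists_iUnion_isClosed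
    exact .union ξ (fun _ => 1) F hlt (fun _ => hlt) fun n => .basic _ (hF n).isOpen_compl
  | union _ η' f hξ hη' h => exact .union ξ η' f (hξ.trans hlt) (fun n => (hη' n).trans hlt) h

lemma inter {s t : Set W} (hs : SigmaOrd ξ s) (ht : SigmaOrd ξ t) : SigmaOrd ξ (s ∩ t) := by
  rcases hs.one_le.eq_or_lt with rfl | hξ
  · exact .basic _ (hs.isOpen.inter ht.isOpen)
  obtain ⟨η, f, hη, hf, rfl⟩ := hs.exists_iUnion hξ
  obtain ⟨θ, g, hθ, hg, rfl⟩ := ht.exists_iUnion hξ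
  rw [iUnion_inter_iUnion]
  refine iUnion fun n => iUnion fun m => of_compl (η := max (η n) (θ m)) ?_ (max_lt (hη n) (hθ m))
  rw [compl_inter]
  exact ((hf n).mono (le_max_left _ _)).union' ((hg m).mono (le_max_right _ _))

end SigmaOrd

lemma SigmaOrd.preimage_of_isGδ {W Z : Type*} [TopologicalSpace W] [TopologicalSpace Z]
    [PseudoMetrizableSpace Z] {ξ : Ordinal.{0}} {s : Set W} (h : SigmaOrd ξ s) (hξ : 3 ≤ ξ) {P : Set Z}
    (hP : IsGδ P) {f : P → W} (hf : Continuous f) :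
    SigmaOrd ξ {x | ∃ hx : x ∈ P, f ⟨x, hx⟩ ∈ s} := by
  obtain ⟨s', hs', h'⟩ := h.exists_preimage hf
  convert (SigmaOrd.of_isGδ hP hξ).inter hs' using 1
  ext x
  simp only [mem_ofPred_eq, mem_inter_iff]
  exact ⟨fun ⟨hx, hx'⟩ => ⟨hx, (h' ⟨x, hx⟩).2 hx'⟩, fun ⟨hx, hx'⟩ => ⟨hx, (h' ⟨x, hx⟩).1 hx'⟩⟩

/-- Universal sets for the additive classes of countable index. -/
lemma exists_universal_sigmaOrd (W : Type*) [TopologicalSpace W] [SecondCountableTopology W]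
    (ξ : Ordinal.{0}) (hcount : ξ.card ≤ Cardinal.aleph0) (hξ : 1 ≤ ξ) :
    ∃ U : Set ((ℕ → Bool) × W), SigmaOrd ξ U ∧
      ∀ s : Set W, SigmaOrd ξ s → ∃ e, s = {x | (e, x) ∈ U} := by
  induction ξ using WellFoundedLT.induction with
  | ind ξ ih =>
  rcases hξ.eq_or_lt with rfl | hξ
  · obtain ⟨b, hbc, -, hb⟩ := exists_countable_basis W
    obtain ⟨O, hO⟩ : ∃ O : ℕ → Set W, insert ∅ b = range O :=
      (hbc.insert ∅).exists_eq_range (insert_nonempty _ _)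
    have hOo : ∀ n, IsOpen (O n) := fun n => by
      have : O n ∈ insert ∅ b := hO ▸ mem_range_self n
      rcases this with h | h
      · rw [h]; exact isOpen_empty
      · exact hb.isOpen h
    refine ⟨⋃ n, {e | e n = true} ×ˢ O n, .basic _ (isOpen_iUnion fun n => ?_), fun s hs => ?_⟩
    · exact ((isOpen_discrete ({true} : Set Bool)).preimage
        (continuous_apply (A := fun _ => Bool) n)).prod (hOo n)
    · classical
      refine ⟨fun n => decide (O n ⊆ s), ?_⟩
      ext x
      simp only [mem_ofPred_eq, mem_iUnion, mem_prod, decide_eq_true_eq]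
      constructor
      · intro hx
        obtain ⟨t, ht, hxt, hts⟩ := hb.exists_subset_of_mem_open hx hs.isOpen
        obtain ⟨n, rfl⟩ : t ∈ range O := hO ▸ mem_insert_of_mem _ ht
        exact ⟨n, hts, hxt⟩
      · rintro ⟨n, h, hx⟩
        exact h hx
  · have hc : (Ico 1 ξ).Countable := by
      have : (Iio ξ).Countable := by
        rw [← Cardinal.le_aleph0_iff_set_countable, Cardinal.mk_Iio_ordinal]
        rw [Cardinal.lift_le_aleph0]
        exact hcount
      exact this.mono Ico_subset_Iio_self
    obtain ⟨q, hq⟩ := hc.exists_eq_range ⟨1, le_rfl, hξ⟩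
    have hqm : ∀ n, q n ∈ Ico 1 ξ := fun n => hq ▸ mem_range_self n
    choose U hU hUu using fun n => ih (q n) (hqm n).2
      ((Ordinal.card_le_card (hqm n).2.le).trans hcount) (hqm n).1
    let col : ℕ → (ℕ → Bool) × W → (ℕ → Bool) × W :=
      fun k p => (fun j => p.1 (Nat.pair k j), p.2)
    have hcol : ∀ k, Continuous (col k) := fun k => by fun_prop
    refine ⟨⋃ k, (col k ⁻¹' U k.unpair.1)ᶜ, .union ξ (fun k => q k.unpair.1) _ hξ
      (fun k => (hqm _).2) fun k => by simpa using (hU _).preimage (hcol k), fun s hs => ?_⟩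
    obtain ⟨η, f, hη, hf, rfl⟩ := hs.exists_iUnion hξ
    have : ∀ n, ∃ i, q i = η n := fun n => by
      have : η n ∈ range q := hq ▸ ⟨(hf n).one_le, hη n⟩
      exact this
    choose i hi using this
    choose e he using fun n => hUu (i n) _ (hi n ▸ hf n)
    choose e' he' using fun n => hUu n Set.univ (SigmaOrd.univ (hqm n).1)
    refine ⟨fun m => (if m.unpair.1.unpair.1 = i m.unpair.1.unpair.2 then
      e m.unpair.1.unpair.2 else e' m.unpair.1.unpair.1) m.unpair.2, ?_⟩
    ext x
    simp only [mem_iUnion, mem_ofPred_eq, mem_compl_iff, mem_preimage, col, Nat.unpair_pair]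
    constructor
    · rintro ⟨n, hn⟩
      refine ⟨Nat.pair (i n) n, ?_⟩
      have := Set.ext_iff.1 (he n) x
      simp only [Nat.unpair_pair, if_true]
      exact fun h => this.2 h hn
    · rintro ⟨k, hk⟩
      by_cases h : k.unpair.1 = i k.unpair.2
      · refine ⟨k.unpair.2, ?_⟩
        have := Set.ext_iff.1 (he k.unpair.2) x
        by_contra hx
        apply hk
        simp only [h, if_true]
        exact this.1 hx
      · refine absurd ?_ hk
        simp only [h, if_false]
        exact (Set.ext_iff.1 (he' k.unpair.1) x).1 trivial

/-- The move read off from the number of steps a player has waited before moving; every value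
occurs infinitely often. -/
def waitValue (n : ℕ) : ℕ := n.unpair.1

lemma waitValue_le (n : ℕ) : waitValue n ≤ n := Nat.unpair_left_le n

lemma exists_waitValue_eq (d m : ℕ) : ∃ n ≥ m, waitValue n = d :=
  ⟨Nat.pair d m, Nat.right_le_pair d m, by simp [waitValue]⟩

/-- The effect of a declared value on the list of moves made so far: `0` is a reset (to the empty
position by player I, who is to move at even positions, and to the position of length `1` by
player II), and `j + 1` is the move `j`. -/
def declare (l : List ℕ) : ℕ → List ℕ
  | 0 => if Even l.length then [] else l.take 1
  | j + 1 => l ++ [j]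

/-- One step of the asynchronous game: the state consists of the moves made so far and of the
waiting time of the player whose turn it is. -/
def gameStep (s : List ℕ × ℕ) (x y : Bool) : List ℕ × ℕ :=
  if (if Even s.1.length then x else y) = true then (declare s.1 (waitValue s.2), 0)
  else (s.1, s.2 + 1)

/-- The state of the asynchronous game after `n` steps; player I plays the bits `a 0, a 2, …`. -/
def gameState (a c : ℕ → Bool) : ℕ → List ℕ × ℕ
  | 0 => ([], 0)
  | n + 1 => gameStep (gameState a c n) (a (2 * n)) (c n)

/-- After time `M` no reset is made and infinitely many moves are made. -/
def GrowsFrom (a c : ℕ → Bool) (M : ℕ) : Prop :=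
  (∀ n ≥ M, (gameState a c n).1 <+: (gameState a c (n + 1)).1) ∧
    ∀ k, ∃ n ≥ M, k ≤ (gameState a c n).1.length

/-- The positions in which player I wins the asynchronous game: either player II is eventually
stuck, or the play is infinite and, its first two moves deleted, belongs to `B`. -/
def WinSet (B : Set ((ℕ → Bool) × (ℕ → ℕ))) : Set ((ℕ → Bool) × (ℕ → Bool) × (ℕ → Bool)) :=
  {p | ∃ K, Odd K ∧ (∃ M, ∀ n ≥ M, K ≤ (gameState p.2.1 p.2.2 n).1.length) ∧
      ∀ M, ∃ n ≥ M, (gameState p.2.1 p.2.2 n).1.length = K} ∪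
    {p | ∃ M γ, GrowsFrom p.2.1 p.2.2 M ∧
      (∀ n ≥ M, ∀ i x, (gameState p.2.1 p.2.2 n).1[i + 2]? = some x → γ i = x) ∧ (p.1, γ) ∈ B}

lemma isLocallyConstant_apply (n : ℕ) : IsLocallyConstant fun c : ℕ → Bool => c n :=
  (IsLocallyConstant.iff_continuous _).2 (continuous_apply n)

lemma isLocallyConstant_gameState (n : ℕ) :
    IsLocallyConstant fun p : (ℕ → Bool) × (ℕ → Bool) => gameState p.1 p.2 n := by
  induction n with
  | zero => exact IsLocallyConstant.const _
  | succ n ih =>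
    have h1 := (isLocallyConstant_apply (2 * n)).comp_continuous
      (continuous_fst (X := ℕ → Bool) (Y := ℕ → Bool))
    have h2 := (isLocallyConstant_apply n).comp_continuous
      (continuous_snd (X := ℕ → Bool) (Y := ℕ → Bool))
    exact (ih.prodMk (h1.prodMk h2)).comp fun q => gameStep q.1 q.2.1 q.2.2

lemma IsLocallyConstant.isClopen_setOf {W T : Type*} [TopologicalSpace W] {f : W → T}
    (hf : IsLocallyConstant f) (p : T → Prop) : IsClopen {x | p (f x)} :=
  ⟨⟨hf {y | ¬ p y}⟩, hf {y | p y}⟩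

lemma List.IsPrefix.getElem?_eq_some {α : Type*} {l l' : List α} (h : l <+: l') {i : ℕ} {x : α}
    (hx : l[i]? = some x) : l'[i]? = some x := by
  obtain ⟨t, rfl⟩ := h
  obtain ⟨hi, -⟩ := List.getElem?_eq_some_iff.1 hx
  rw [List.getElem?_append_left hi, hx]

lemma isPrefix_of_forall_succ {α : Type*} {l : ℕ → List α} {M : ℕ}
    (h : ∀ n ≥ M, l n <+: l (n + 1)) {m n : ℕ} (hm : M ≤ m) (hmn : m ≤ n) : l m <+: l n := by
  induction n, hmn using Nat.le_induction with
  | base => exact List.prefix_rfl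
  | succ n hn ih => exact ih.trans (h n (hm.trans hn))

lemma GrowsFrom.exists_limit {a c : ℕ → Bool} {M : ℕ} (h : GrowsFrom a c M) (i : ℕ) :
    ∃ k, (∃ n ≥ M, (gameState a c n).1[i + 2]? = some k) ∧
      ∀ n ≥ M, ∀ x, (gameState a c n).1[i + 2]? = some x → k = x := by
  obtain ⟨n, hn, hk⟩ := h.2 (i + 3)
  refine ⟨(gameState a c n).1[i + 2], ⟨n, hn, by simp⟩, fun m hm x hx => ?_⟩
  have h0 : (gameState a c n).1[i + 2]? = some ((gameState a c n).1[i + 2]) := by simp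
  have h1 := (isPrefix_of_forall_succ h.1 hn (le_max_left n m)).getElem?_eq_some h0
  have h2 := (isPrefix_of_forall_succ h.1 hm (le_max_right n m)).getElem?_eq_some hx
  rw [h1] at h2
  exact Option.some_injective _ h2

lemma isGδ_growsFrom (M : ℕ) :
    IsGδ {p : (ℕ → Bool) × (ℕ → Bool) × (ℕ → Bool) | GrowsFrom p.2.1 p.2.2 M} := by
  have hc : ∀ n, IsLocallyConstant
      fun p : (ℕ → Bool) × (ℕ → Bool) × (ℕ → Bool) => gameState p.2.1 p.2.2 n := fun n =>
    (isLocallyConstant_gameState n).comp_continuous continuous_snd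
  have h1 : IsGδ {p : (ℕ → Bool) × (ℕ → Bool) × (ℕ → Bool) |
      ∀ n ≥ M, (gameState p.2.1 p.2.2 n).1 <+: (gameState p.2.1 p.2.2 (n + 1)).1} := by
    simp only [ofPred_forall]
    exact .iInter fun n => .iInter fun _ => (((hc n).prodMk (hc (n + 1))).isClopen_setOf
      fun q => q.1.1 <+: q.2.1).isOpen.isGδ
  have h2 : IsGδ {p : (ℕ → Bool) × (ℕ → Bool) × (ℕ → Bool) |
      ∀ k, ∃ n ≥ M, k ≤ (gameState p.2.1 p.2.2 n).1.length} := by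
    simp only [ofPred_forall]
    refine .iInter fun k => IsOpen.isGδ ?_
    simp only [ofPred_exists]
    refine isOpen_iUnion fun n => ?_
    exact ((hc n).isClopen_setOf fun q => n ≥ M ∧ k ≤ q.1.length).isOpen
  exact h1.inter h2

/-- The infinite plays won by player I form a set of class `ξ`. -/
lemma sigmaOrd_winSet {ξ : Ordinal.{0}} (hξ : 3 ≤ ξ) {B : Set ((ℕ → Bool) × (ℕ → ℕ))}
    (hB : SigmaOrd ξ B) : SigmaOrd ξ (WinSet B) := by
  have hc : ∀ n, IsLocallyConstant
      fun p : (ℕ → Bool) × (ℕ → Bool) × (ℕ → Bool) => gameState p.2.1 p.2.2 n := fun n =>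
    (isLocallyConstant_gameState n).comp_continuous continuous_snd
  have h2ξ : 2 ≤ ξ := le_trans (by norm_num) hξ
  refine SigmaOrd.union' ?_ ?_
  · have : {p : (ℕ → Bool) × (ℕ → Bool) × (ℕ → Bool) | ∃ K, Odd K ∧
        (∃ M, ∀ n ≥ M, K ≤ (gameState p.2.1 p.2.2 n).1.length) ∧
        ∀ M, ∃ n ≥ M, (gameState p.2.1 p.2.2 n).1.length = K} =
        ⋃ K : ℕ, (⋃ M, {p | Odd K ∧ ∀ n ≥ M, K ≤ (gameState p.2.1 p.2.2 n).1.length}) ∩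
          ⋂ M, {p | ∃ n ≥ M, (gameState p.2.1 p.2.2 n).1.length = K} := by
      ext p
      simp only [mem_ofPred_eq, mem_iUnion, mem_inter_iff, mem_iInter]
      grind
    rw [this]
    refine SigmaOrd.iUnion fun K => SigmaOrd.inter (SigmaOrd.iUnion fun M => ?_)
      (SigmaOrd.of_isGδ (.iInter fun M => IsOpen.isGδ ?_) hξ)
    · refine SigmaOrd.of_isClosed ?_ h2ξ
      simp only [ofPred_and, ofPred_forall]
      exact isClosed_const.inter (isClosed_iInter fun n => isClosed_iInter fun _ =>
        ((hc n).isClopen_setOf fun q => K ≤ q.1.length).isClosed)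
    · simp only [ofPred_exists]
      exact isOpen_iUnion fun n =>
        ((hc n).isClopen_setOf fun q => n ≥ M ∧ q.1.length = K).isOpen
  · have : ∀ M, SigmaOrd ξ {p : (ℕ → Bool) × (ℕ → Bool) × (ℕ → Bool) |
        ∃ γ, GrowsFrom p.2.1 p.2.2 M ∧
          (∀ n ≥ M, ∀ i x, (gameState p.2.1 p.2.2 n).1[i + 2]? = some x → γ i = x) ∧
          (p.1, γ) ∈ B} := by
      intro M
      choose γ hγ hγ' using fun (p : {p : (ℕ → Bool) × (ℕ → Bool) × (ℕ → Bool) |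
        GrowsFrom p.2.1 p.2.2 M}) => (GrowsFrom.exists_limit p.2)
      have hcont : Continuous γ := by
        refine continuous_pi fun i => continuous_discrete_rng.2 fun k => ?_
        have : (fun p => γ p i) ⁻¹' {k} = Subtype.val ⁻¹' ⋃ n,
            {p : (ℕ → Bool) × (ℕ → Bool) × (ℕ → Bool) |
              n ≥ M ∧ (gameState p.2.1 p.2.2 n).1[i + 2]? = some k} := by
          ext p
          simp only [mem_preimage, mem_singleton_iff, mem_iUnion, mem_ofPred_eq]
          constructor
          · rintro rfl
            exact hγ p i
          · rintro ⟨n, hn, h⟩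
            exact hγ' p i n hn k h
        rw [this]
        exact (isOpen_iUnion fun n => ((hc n).isClopen_setOf
          fun q => n ≥ M ∧ q.1[i + 2]? = some k).isOpen).preimage continuous_subtype_val
      convert hB.preimage_of_isGδ hξ (isGδ_growsFrom M)
        (f := fun p => (p.1.1, γ p)) (by fun_prop) using 1
      ext p
      simp only [mem_ofPred_eq]
      constructor
      · rintro ⟨δ, hp, hδ, hB⟩
        refine ⟨hp, ?_⟩
        convert hB using 2
        funext i
        obtain ⟨n, hn, h⟩ := hγ ⟨p, hp⟩ i
        exact (hδ n hn i _ h).symm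
      · rintro ⟨hp, h⟩
        exact ⟨_, hp, fun n hn i x hx => hγ' ⟨p, hp⟩ i n hn x hx, h⟩
    convert SigmaOrd.iUnion this using 1
    ext p
    simp

/-- The first `k` moves of player II recorded in a list of moves. -/
def movesII (l : List ℕ) (k : ℕ) : List ℕ := (List.range k).map fun i => l.getD (2 * i + 3) 0

/-- The value which player I wants to declare: he resets, opens with the mark `N`, and then follows
the strategy `σ`. -/
def wantedValue (σ : List ℕ → ℕ) (N : ℕ) (l : List ℕ) : ℕ :=
  if l.head? = some N then σ (movesII l ((l.length - 2) / 2)) + 1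
  else if l = [] then N + 1 else 0

/-- The moves of player I recorded in a list of moves follow the strategy `σ`. -/
def Obeys (σ : List ℕ → ℕ) (l : List ℕ) : Prop :=
  ∀ k x, l[2 * k + 2]? = some x → x = σ (movesII l k)

lemma movesII_append {l t : List ℕ} {k : ℕ} (h : 2 * k + 2 ≤ l.length) :
    movesII (l ++ t) k = movesII l k := by
  refine List.map_congr_left fun i hi => ?_
  rw [List.mem_range] at hi
  exact List.getD_append _ _ _ _ (by omega)

lemma Obeys.append {σ : List ℕ → ℕ} {l : List ℕ} (h : Obeys σ l) {x : ℕ}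
    (hx : ∀ k, l.length = 2 * k + 2 → x = σ (movesII l k)) : Obeys σ (l ++ [x]) := by
  intro k y hy
  rcases lt_trichotomy (2 * k + 2) l.length with hk | hk | hk
  · rw [List.getElem?_append_left hk] at hy
    rw [movesII_append hk.le]
    exact h k y hy
  · rw [movesII_append hk.le, ← hx k hk.symm]
    rw [hk, List.getElem?_concat_length] at hy
    exact (Option.some_injective _ hy).symm
  · rw [List.getElem?_eq_none (by simp; omega)] at hy
    cases hy

lemma obeys_of_length_le {σ : List ℕ → ℕ} {l : List ℕ} (h : l.length ≤ 2) : Obeys σ l := by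
  intro k x hx
  rw [List.getElem?_eq_none (by omega)] at hx
  cases hx

/-- A sequence of states in which player I, from time `N` on, declares the wanted values. -/
structure IsReplyRun (σ : List ℕ → ℕ) (N : ℕ) (c : ℕ → Bool) (s : ℕ → List ℕ × ℕ) : Prop where
  head_ne : (s N).1.head? ≠ some N
  step : ∀ n ≥ N, s (n + 1) =
    gameStep (s n) (decide (waitValue (s n).2 = wantedValue σ N (s n).1)) (c n)

namespace IsReplyRun

variable {σ : List ℕ → ℕ} {N : ℕ} {c : ℕ → Bool} {s : ℕ → List ℕ × ℕ}

lemma step_cases (h : IsReplyRun σ N c s) {n : ℕ} (hn : N ≤ n) :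
    (s (n + 1)).1 = (s n).1 ∨
    (Even (s n).1.length ∧ (s (n + 1)).1 = declare (s n).1 (wantedValue σ N (s n).1)) ∨
    (Odd (s n).1.length ∧ (s (n + 1)).1 = (s n).1.take 1) ∨
    (Odd (s n).1.length ∧ ∃ j, (s (n + 1)).1 = (s n).1 ++ [j]) := by
  rw [h.step n hn, gameStep]
  by_cases he : Even (s n).1.length
  · simp only [he, if_true, decide_eq_true_eq]
    split_ifs with h1
    · exact .inr (.inl ⟨trivial, by rw [h1]⟩)
    · exact .inl rfl
  · simp only [he, if_false]
    split_ifs with h1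
    · right; right
      rw [Nat.not_even_iff_odd] at he
      rcases hw : waitValue (s n).2 with _ | j
      · exact .inl ⟨he, by simp [declare, he]⟩
      · exact .inr ⟨he, j, rfl⟩
    · exact .inl rfl

lemma exists_declare (h : IsReplyRun σ N c s) {n : ℕ} (hn : N ≤ n) (he : Even (s n).1.length) :
    ∃ n' ≥ n, (s n').1 = (s n).1 ∧
      (s (n' + 1)).1 = declare (s n).1 (wantedValue σ N (s n).1) := by
  obtain ⟨m, hm, hw⟩ := exists_waitValue_eq (wantedValue σ N (s n).1) (s n).2
  by_contra! hcon
  have key : ∀ i, s (n + i) = ((s n).1, (s n).2 + i) := by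
    intro i
    induction i with
    | zero => simp
    | succ i ih =>
      have := hcon (n + i) (by omega) (by rw [ih])
      have hs := h.step (n + i) (by omega)
      rw [ih] at hs
      simp only [gameStep, he, if_true, decide_eq_true_eq] at hs
      split_ifs at hs with h1
      · rw [hs, h1] at this
        exact absurd rfl this
      · rw [← add_assoc, hs, add_assoc]
  have h1 := key (m - (s n).2)
  have h2 := hcon (n + (m - (s n).2)) (by omega) (by rw [h1])
  rw [h.step _ (by omega), h1, show (s n).2 + (m - (s n).2) = m by omega] at h2
  simp [gameStep, he, hw] at h2

lemma head_succ (h : IsReplyRun σ N c s) {n : ℕ} (hn : N ≤ n) (hh : (s n).1.head? = some N) :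
    (s (n + 1)).1.head? = some N := by
  rcases h.step_cases hn with h1 | ⟨_, h1⟩ | ⟨_, h1⟩ | ⟨_, j, h1⟩
  · rwa [h1]
  · rw [h1, wantedValue, if_pos hh, declare, List.head?_append, hh]; rfl
  · rw [h1]; simpa [List.head?_take] using hh
  · rw [h1, List.head?_append, hh]; rfl

lemma head_of_le (h : IsReplyRun σ N c s) {n m : ℕ} (hn : N ≤ n) (hh : (s n).1.head? = some N)
    (hm : n ≤ m) : (s m).1.head? = some N := by
  induction m, hm using Nat.le_induction with
  | base => exact hh
  | succ m hm ih => exact h.head_succ (hn.trans hm) ih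

lemma obeys (h : IsReplyRun σ N c s) {n : ℕ} (hn : N ≤ n) (hh : (s n).1.head? = some N) :
    Obeys σ (s n).1 := by
  induction n, hn using Nat.le_induction with
  | base => exact absurd hh h.head_ne
  | succ n hn ih =>
    by_cases hh' : (s n).1.head? = some N
    · specialize ih hh'
      rcases h.step_cases hn with h1 | ⟨_, h1⟩ | ⟨_, h1⟩ | ⟨ho, j, h1⟩
      · rwa [h1]
      · rw [h1, wantedValue, if_pos hh', declare]
        refine ih.append fun k hk => ?_
        rw [hk, show (2 * k + 2 - 2) / 2 = k by omega]
      · exact obeys_of_length_le (by rw [h1]; simp)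
      · rw [h1]
        refine ih.append fun k hk => ?_
        rw [hk] at ho
        grind
    · refine obeys_of_length_le ?_
      rcases h.step_cases hn with h1 | ⟨_, h1⟩ | ⟨_, h1⟩ | ⟨ho, j, h1⟩
      · rw [h1] at hh
        exact absurd hh hh'
      · rw [wantedValue, if_neg hh'] at h1
        split_ifs at h1 with h2
        · rw [h1, h2]; simp [declare]
        · rw [h1, declare]
          split_ifs
          simp
      · rw [h1]; simp
      · have : (s n).1 ≠ [] := by
          rintro h2
          simp [h2] at ho
        rw [h1, List.head?_append_of_ne_nil _ this] at hh
        exact absurd hh hh'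

lemma exists_head (h : IsReplyRun σ N c s) {n : ℕ} (hn : N ≤ n) (he : Even (s n).1.length) :
    ∃ m ≥ n, (s m).1.head? = some N := by
  have nil : ∀ n ≥ N, (s n).1 = [] → ∃ m ≥ n, (s m).1.head? = some N := by
    intro n hn h0
    obtain ⟨m, hm, -, h1⟩ := h.exists_declare hn (by simp [h0])
    refine ⟨m + 1, by omega, ?_⟩
    rw [h1, h0]
    simp [wantedValue, declare]
  by_cases h1 : (s n).1.head? = some N
  · exact ⟨n, le_rfl, h1⟩
  by_cases h2 : (s n).1 = []
  · exact nil n hn h2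
  · obtain ⟨m, hm, -, h3⟩ := h.exists_declare hn he
    rw [wantedValue, if_neg h1, if_neg h2, declare, if_pos he] at h3
    obtain ⟨k, hk, hk'⟩ := nil (m + 1) (by omega) h3
    exact ⟨k, by omega, hk'⟩

lemma length_succ_le (h : IsReplyRun σ N c s) {n : ℕ} (hn : N ≤ n) :
    (s (n + 1)).1.length ≤ (s n).1.length + 1 := by
  have hd : ∀ l d, (declare l d).length ≤ l.length + 1 := by
    intro l d
    rcases d with _ | d
    · rw [declare]
      split_ifs <;> simp
    · simp [declare]
  rcases h.step_cases hn with h1 | ⟨_, h1⟩ | ⟨_, h1⟩ | ⟨ho, j, h1⟩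
  · rw [h1]; omega
  · rw [h1]; exact hd _ _
  · rw [h1]; simp
  · rw [h1]; simp

/-- Eventually the position is not empty. -/
lemma exists_one_le (h : IsReplyRun σ N c s) : ∃ M ≥ N, ∀ n ≥ M, 1 ≤ (s n).1.length := by
  by_cases hE : ∃ n ≥ N, Even (s n).1.length
  · obtain ⟨n, hn, he⟩ := hE
    obtain ⟨m, hm, hh⟩ := h.exists_head hn he
    refine ⟨m, by omega, fun k hk => ?_⟩
    have := h.head_of_le (by omega) hh hk
    by_contra! h0
    simp [List.length_eq_zero_iff.1 (Nat.lt_one_iff.1 h0)] at this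
  · push Not at hE
    exact ⟨N, le_rfl, fun n hn => (Nat.not_even_iff_odd.1 (hE n hn)).pos⟩

lemma isPrefix_of_two_le (h : IsReplyRun σ N c s) {M : ℕ} (hM : N ≤ M)
    (h2 : ∀ n ≥ M, 2 ≤ (s n).1.length) : ∀ n ≥ M, (s n).1 <+: (s (n + 1)).1 := by
  intro n hn
  have := h2 (n + 1) (by omega)
  rcases h.step_cases (hM.trans hn) with h1 | ⟨he, h1⟩ | ⟨_, h1⟩ | ⟨ho, j, h1⟩
  · rw [h1]
  · rcases hd : wantedValue σ N (s n).1 with _ | d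
    · rw [h1, hd, declare, if_pos he] at this
      simp at this
    · rw [h1, hd, declare]
      exact List.prefix_append _ _
  · rw [h1] at this
    simp at this
  · rw [h1]
    exact List.prefix_append _ _

end IsReplyRun

lemma IsReplyRun.mem_winSet {σ : List ℕ → ℕ} {N : ℕ} {a c v : ℕ → Bool}
    {B : Set ((ℕ → Bool) × (ℕ → ℕ))} (hσ : ∀ β, (v, playI σ β) ∈ B)
    (h : IsReplyRun σ N c (gameState a c)) : (v, a, c) ∈ WinSet B := by
  obtain ⟨M₀, hM₀, h1⟩ := h.exists_one_le
  by_cases hinf : ∀ M, ∃ n ≥ M, (gameState a c n).1.length = 1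
  · exact .inl ⟨1, odd_one, ⟨M₀, h1⟩, hinf⟩
  push Not at hinf
  obtain ⟨M₁, hM₁⟩ := hinf
  set M := max M₀ M₁
  have h2 : ∀ n ≥ M, 2 ≤ (gameState a c n).1.length := fun n hn => by
    have := h1 n (le_trans (le_max_left _ _) hn)
    have := hM₁ n (le_trans (le_max_right _ _) hn)
    omega
  have hNM : N ≤ M := hM₀.trans (le_max_left _ _)
  have hpre := h.isPrefix_of_two_le hNM h2
  by_cases hunb : ∀ k, ∃ n ≥ M, k ≤ (gameState a c n).1.length
  · right
    have hE : ∃ n ≥ M, Even (gameState a c n).1.length := by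
      by_contra! hodd
      have : ∀ n ≥ M, (gameState a c n).1.length ≤ (gameState a c M).1.length := by
        intro n hn
        induction n, hn using Nat.le_induction with
        | base => exact le_rfl
        | succ n hn ih =>
          have h3 := Nat.not_even_iff_odd.1 (hodd n hn)
          have h4 := Nat.not_even_iff_odd.1 (hodd (n + 1) (by omega))
          have h5 := h.length_succ_le (hNM.trans hn)
          grind
      obtain ⟨n, hn, hn'⟩ := hunb ((gameState a c M).1.length + 1)
      have := this n hn
      omega
    obtain ⟨n₀, hn₀, he⟩ := hE
    obtain ⟨m, hm, hh⟩ := h.exists_head (hNM.trans hn₀) he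
    have hg : GrowsFrom a c m := by
      refine ⟨fun n hn => hpre n (by omega), fun k => ?_⟩
      obtain ⟨n, hn, hk⟩ := hunb k
      exact ⟨max n m, le_max_right _ _,
        hk.trans (isPrefix_of_forall_succ hpre hn (le_max_left _ _)).length_le⟩
    choose γ hγ hγ' using hg.exists_limit
    refine ⟨m, γ, hg, fun n hn i => hγ' i n hn, ?_⟩
    have : γ = playI σ fun k => γ (2 * k + 1) := by
      funext i
      rw [playI]
      split_ifs with hi
      · obtain ⟨k, rfl⟩ : ∃ k, i = 2 * k := ⟨i / 2, by omega⟩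
        obtain ⟨n, hn, hx⟩ := hγ (2 * k)
        rw [h.obeys (by omega) (h.head_of_le (by omega) hh hn) k _ hx]
        congr 1
        rw [movesII, show 2 * k / 2 = k by omega, List.ofFn_eq_map, ← List.map_coe_finRange_eq_range,
          List.map_map]
        refine List.map_congr_left fun j _ => ?_
        have hlen : 2 * k + 2 < (gameState a c n).1.length := (List.getElem?_eq_some_iff.1 hx).1
        simp only [Function.comp]
        rw [List.getD_eq_getElem _ _ (by omega)]
        symm
        exact hγ' (2 * j + 1) n hn _ (List.getElem?_eq_getElem _)
      · exact congrArg γ (by omega)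
    rw [this]
    exact hσ _
  · left
    push Not at hunb
    obtain ⟨K, hK⟩ := hunb
    have hmono : ∀ {m n}, M ≤ m → m ≤ n →
        (gameState a c m).1.length ≤ (gameState a c n).1.length := fun hm hmn =>
      (isPrefix_of_forall_succ hpre hm hmn).length_le
    obtain ⟨L, ⟨n₁, hn₁, hL⟩, hmax⟩ : ∃ L, (∃ n ≥ M, (gameState a c n).1.length = L) ∧
        ∀ n ≥ M, (gameState a c n).1.length ≤ L := by
      let S := {L | ∃ n ≥ M, (gameState a c n).1.length = L}
      have hb : BddAbove S := ⟨K, by rintro _ ⟨n, hn, rfl⟩; exact (hK n hn).le⟩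
      have hne : S.Nonempty := ⟨_, M, le_rfl, rfl⟩
      exact ⟨sSup S, Nat.sSup_mem hne hb, fun n hn => le_csSup hb ⟨n, hn, rfl⟩⟩
    have hconst : ∀ n ≥ n₁, (gameState a c n).1.length = L := fun n hn =>
      le_antisymm (hmax n (by omega)) (hL ▸ hmono hn₁ hn)
    refine ⟨L, ?_, ⟨n₁, fun n hn => (hconst n hn).ge⟩,
      fun m => ⟨max n₁ m, le_max_right _ _, hconst _ (le_max_left _ _)⟩⟩
    by_contra hodd
    rw [Nat.not_odd_iff_even] at hodd
    obtain ⟨n', hn', -, h3⟩ := h.exists_declare (n := n₁) (by omega) (by rwa [hL])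
    have h4 := hconst (n' + 1) (by omega)
    have h5 := h2 (n' + 1) (by omega)
    rcases hd : wantedValue σ N (gameState a c n₁).1 with _ | d
    · rw [h3, hd, declare, if_pos (by rwa [hL])] at h5
      simp at h5
    · rw [h3, hd, declare] at h4
      simp at h4
      omega

/-- The bit played by player I in the state `s` at time `n`; before time `N` it is prescribed. -/
def replyBit (z : ℕ → Bool) (σ : List ℕ → ℕ) (N n : ℕ) (s : List ℕ × ℕ) : Bool :=
  if n < N then z (2 * n) else decide (waitValue s.2 = wantedValue σ N s.1)

/-- The run in which player I plays the bits `replyBit`. -/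
def replyRun (z : ℕ → Bool) (σ : List ℕ → ℕ) (N : ℕ) (c : ℕ → Bool) : ℕ → List ℕ × ℕ
  | 0 => ([], 0)
  | n + 1 => gameStep (replyRun z σ N c n) (replyBit z σ N n (replyRun z σ N c n)) (c n)

/-- The sequence of bits played by player I against `c`. -/
def reply (z : ℕ → Bool) (σ : List ℕ → ℕ) (N : ℕ) (c : ℕ → Bool) (i : ℕ) : Bool :=
  if i < 2 * N then z i
  else xor (decide (i % 2 = 1)) (replyBit z σ N (i / 2) (replyRun z σ N c (i / 2)))

lemma isLocallyConstant_replyRun (z : ℕ → Bool) (σ : List ℕ → ℕ) (N n : ℕ) :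
    IsLocallyConstant fun c => replyRun z σ N c n := by
  induction n with
  | zero => exact IsLocallyConstant.const _
  | succ n ih =>
    exact (ih.prodMk (isLocallyConstant_apply n)).comp
      fun q => gameStep q.1 (replyBit z σ N n q.1) q.2

lemma continuous_reply (z : ℕ → Bool) (σ : List ℕ → ℕ) (N : ℕ) : Continuous (reply z σ N) := by
  refine continuous_pi fun i => IsLocallyConstant.continuous ?_
  exact (isLocallyConstant_replyRun z σ N (i / 2)).comp fun s =>
    if i < 2 * N then z i else xor (decide (i % 2 = 1)) (replyBit z σ N (i / 2) s)

lemma reply_even (z : ℕ → Bool) (σ : List ℕ → ℕ) (N : ℕ) (c : ℕ → Bool) (n : ℕ) :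
    reply z σ N c (2 * n) = replyBit z σ N n (replyRun z σ N c n) := by
  rw [reply, show 2 * n / 2 = n by omega]
  split_ifs with h
  · rw [replyBit, if_pos (by omega)]
  · simp

lemma gameState_reply (z : ℕ → Bool) (σ : List ℕ → ℕ) (N : ℕ) (c : ℕ → Bool) (n : ℕ) :
    gameState (reply z σ N c) c n = replyRun z σ N c n := by
  induction n with
  | zero => rfl
  | succ n ih => rw [gameState, replyRun, ih, reply_even]

lemma gameState_bound (a c : ℕ → Bool) (n : ℕ) :
    (gameState a c n).2 ≤ n ∧ ∀ x ∈ (gameState a c n).1, x < n := by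
  induction n with
  | zero => simp [gameState]
  | succ n ih =>
    rw [gameState]
    generalize gameState a c n = s at ih
    have hd : ∀ x ∈ declare s.1 (waitValue s.2), x < n + 1 := by
      have := (waitValue_le s.2).trans ih.1
      generalize waitValue s.2 = d at this ⊢
      rcases d with _ | j <;> rw [declare]
      · split_ifs
        · simp
        · exact fun x hx => (ih.2 x (List.mem_of_mem_take hx)).trans n.lt_succ_self
      · intro x hx
        rcases List.mem_append.1 hx with hx | hx
        · exact (ih.2 x hx).trans n.lt_succ_self
        · simp at hx; omega
    have hx : ∀ x ∈ s.1, x < n + 1 := fun x hx => (ih.2 x hx).trans n.lt_succ_self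
    rw [gameStep]
    split_ifs <;> simp_all

lemma isReplyRun_reply (z : ℕ → Bool) (σ : List ℕ → ℕ) (N : ℕ) (c : ℕ → Bool) :
    IsReplyRun σ N c (gameState (reply z σ N c) c) where
  head_ne h := (gameState_bound _ _ N).2 N (List.mem_of_head? h) |>.false
  step n hn := by
    rw [gameState, reply_even, replyBit, if_neg (by omega), gameState_reply]

/-- If player I wins the game, then he can reply continuously in the asynchronous game, starting
with any prescribed bits and never becoming eventually constant. -/
lemma exists_continuous_reply {B : Set ((ℕ → Bool) × (ℕ → ℕ))} {v : ℕ → Bool}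
    (h : PlayerIWins {γ | (v, γ) ∈ B}) (z : ℕ → Bool) (N : ℕ) :
    ∃ a : (ℕ → Bool) → ℕ → Bool, Continuous a ∧ ∀ c, (∀ i < 2 * N, a c i = z i) ∧
      (∀ n ≥ N, a c (2 * n + 1) = !a c (2 * n)) ∧ (v, a c, c) ∈ WinSet B := by
  obtain ⟨σ, hσ⟩ := h
  refine ⟨reply z σ N, continuous_reply z σ N, fun c => ⟨fun i hi => if_pos hi, fun n hn => ?_,
    (isReplyRun_reply z σ N c).mem_winSet hσ⟩⟩
  rw [reply, reply, if_neg (by omega), if_neg (by omega), show (2 * n + 1) / 2 = n by omega,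
    show 2 * n / 2 = n by omega]
  simp

lemma exists_forall_agree_mem {T : Type*} [TopologicalSpace T] [DiscreteTopology T]
    {c : ℕ → T} {U : Set (ℕ → T)} (hU : U ∈ 𝓝 c) :
    ∃ m, ∀ c', (∀ i < m, c' i = c i) → c' ∈ U := by
  obtain ⟨V, hVU, hV, hcV⟩ := mem_nhds_iff.1 hU
  obtain ⟨_, ⟨x, n, rfl⟩, hc, hn⟩ :=
    (PiNat.isTopologicalBasis_cylinders (fun _ : ℕ => T)).exists_subset_of_mem_open hcV hV
  refine ⟨n, fun c' hc' => hVU (hn ?_)⟩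
  rw [← PiNat.mem_cylinder_iff_eq.1 hc]
  exact PiNat.mem_cylinder_iff.2 hc'

section ContinuousReply

variable {B : Set ((ℕ → Bool) × (ℕ → ℕ))} {v : ℕ → Bool} {a : (ℕ → Bool) → ℕ → Bool}

lemma isLocallyConstant_gameState_apply (ha : Continuous a) (n : ℕ) :
    IsLocallyConstant fun c => gameState (a c) c n :=
  (isLocallyConstant_gameState n).comp_continuous (ha.prodMk continuous_id)

lemma exists_modulus (ha : Continuous a) (c : ℕ → Bool) (n : ℕ) :
    ∃ m, ∀ c', (∀ i < m, c' i = c i) → ∀ k ≤ n, gameState (a c') c' k = gameState (a c) c k := by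
  have : {c' | ∀ k ≤ n, gameState (a c') c' k = gameState (a c) c k} ∈ 𝓝 c := by
    refine IsOpen.mem_nhds ?_ fun k _ => rfl
    simp only [ofPred_forall]
    exact (Set.finite_Iic n).isOpen_biInter fun k _ =>
      ((isLocallyConstant_gameState_apply ha k).isClopen_setOf
        fun s => s = gameState (a c) c k).isOpen
  exact exists_forall_agree_mem this

lemma exists_one_le_of_mem_winSet {a c : ℕ → Bool} (h : (v, a, c) ∈ WinSet B) :
    ∃ M, ∀ n ≥ M, 1 ≤ (gameState a c n).1.length := by
  rcases h with ⟨K, hK, ⟨M, hM⟩, -⟩ | ⟨M, -, hg, -⟩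
  · exact ⟨M, fun n hn => hK.pos.trans_le (hM n hn)⟩
  · obtain ⟨n, hn, h1⟩ := hg.2 1
    exact ⟨n, fun m hm => h1.trans (isPrefix_of_forall_succ hg.1 hn hm).length_le⟩

/-- By the Baire category theorem, on some basic open set the position is uniformly eventually not
empty. -/
lemma exists_forall_one_le (ha : Continuous a) (hw : ∀ c, (v, a c, c) ∈ WinSet B) :
    ∃ c₀ : ℕ → Bool, ∃ n₀, ∀ c, (∀ i < n₀, c i = c₀ i) →
      ∀ n ≥ n₀, 1 ≤ (gameState (a c) c n).1.length := by
  obtain ⟨p, c₀, hc₀⟩ := nonempty_interior_of_iUnion_of_closed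
    (f := fun p => {c | ∀ n ≥ p, 1 ≤ (gameState (a c) c n).1.length})
    (fun p => by
      simp only [ofPred_forall]
      exact isClosed_iInter fun n => isClosed_iInter fun _ =>
        ((isLocallyConstant_gameState_apply ha n).isClopen_setOf
          fun s => 1 ≤ s.1.length).isClosed)
    (eq_univ_of_forall fun c => mem_iUnion.2 (exists_one_le_of_mem_winSet (hw c)))
  obtain ⟨m, hm⟩ := exists_forall_agree_mem (isOpen_interior.mem_nhds hc₀)
  exact ⟨c₀, max m p, fun c hc n hn =>
    interior_subset (hm c fun i hi => hc i (lt_max_of_lt_left hi)) n (le_of_max_le_right hn)⟩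

/-- When player I is to move, he eventually moves. -/
lemma exists_move {a c : ℕ → Bool} (h : (v, a, c) ∈ WinSet B) {T : ℕ}
    (h1 : ∀ n ≥ T, 1 ≤ (gameState a c n).1.length) (he : Even (gameState a c T).1.length) :
    ∃ T₁ > T, ∃ j, (∀ n, T ≤ n → n < T₁ → (gameState a c n).1 = (gameState a c T).1) ∧
      (gameState a c T₁).1 = (gameState a c T).1 ++ [j] := by
  have hex : ∃ n, T ≤ n ∧ (gameState a c n).1 ≠ (gameState a c T).1 := by
    by_contra! hcon
    rcases h with ⟨K, hK, -, hK'⟩ | ⟨M, -, hg, -⟩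
    · obtain ⟨n, hn, hn'⟩ := hK' T
      rw [hcon n hn] at hn'
      exact Nat.not_even_iff_odd.2 hK (hn' ▸ he)
    · obtain ⟨n, hn, h2⟩ := hg.2 ((gameState a c T).1.length + 1)
      have h3 := (isPrefix_of_forall_succ hg.1 hn (le_max_left n T)).length_le
      rw [hcon _ (le_max_right n T)] at h3
      exact absurd (h2.trans h3) (by simp)
  classical
  obtain ⟨hT, hne⟩ := Nat.find_spec hex
  have hmin : ∀ n, T ≤ n → n < Nat.find hex → (gameState a c n).1 = (gameState a c T).1 := by
    intro n hn hlt
    by_contra hcon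
    exact Nat.find_min hex hlt ⟨hn, hcon⟩
  generalize Nat.find hex = T₁ at hT hne hmin
  have hlt : T < T₁ := lt_of_le_of_ne hT (by rintro rfl; exact hne rfl)
  obtain ⟨n, rfl⟩ : ∃ n, T₁ = n + 1 := ⟨T₁ - 1, by omega⟩
  have hn := hmin n (by omega) (by omega)
  have h2 := h1 (n + 1) (by omega)
  rw [gameState, gameStep, hn, if_pos he] at hne h2
  split_ifs at hne h2 with hx
  · rcases hd : waitValue (gameState a c n).2 with _ | j
    · rw [hd, declare, if_pos he] at h2
      simp at h2
    · refine ⟨n + 1, hlt, j, hmin, ?_⟩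
      rw [gameState, gameStep, hn, if_pos he, if_pos hx, hd, declare]
  · exact absurd rfl hne

/-- When player II is to move, he can declare any value in such a way that the run up to this
moment depends only on the bits played so far. -/
lemma exists_declare (ha : Continuous a) {c : ℕ → Bool} {T : ℕ} (h0 : ∀ i ≥ T, c i = false)
    (ho : Odd (gameState (a c) c T).1.length) (d : ℕ) :
    ∃ c' : ℕ → Bool, ∃ T' > T, (∀ i < T, c' i = c i) ∧ (∀ i ≥ T', c' i = false) ∧
      ∀ c'', (∀ i < T', c'' i = c' i) →
        (∀ n ≤ T, gameState (a c'') c'' n = gameState (a c) c n) ∧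
        (∀ n, T ≤ n → n < T' → (gameState (a c'') c'' n).1 = (gameState (a c) c T).1) ∧
        gameState (a c'') c'' T' = (declare (gameState (a c) c T).1 d, 0) := by
  obtain ⟨m, hm⟩ := exists_modulus ha c T
  generalize hs : gameState (a c) c T = s at ho
  obtain ⟨l, w⟩ := s
  obtain ⟨k, hk, hkd⟩ := exists_waitValue_eq d (w + m)
  have ho' : ¬ Even l.length := Nat.not_even_iff_odd.2 ho
  refine ⟨Function.update c (T + (k - w)) true, T + (k - w) + 1, by omega,
    fun i hi => Function.update_of_ne (by omega) _ _, fun i hi => ?_, fun c'' hc'' => ?_⟩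
  · rw [Function.update_of_ne (by omega)]
    exact h0 i (by omega)
  have hagree : ∀ i < T + (k - w), c'' i = c i := fun i hi => by
    rw [hc'' i (by omega), Function.update_of_ne hi.ne]
  have hT : ∀ n ≤ T, gameState (a c'') c'' n = gameState (a c) c n :=
    hm c'' fun i hi => hagree i (by omega)
  have hwait : ∀ i ≤ k - w, gameState (a c'') c'' (T + i) = (l, w + i) := by
    intro i hi
    induction i with
    | zero => rw [add_zero, hT T le_rfl, hs]; rfl
    | succ i ih =>
      rw [← add_assoc, gameState, ih (by omega), gameStep, if_neg ho',
        hagree (T + i) (by omega), h0 _ (by omega), if_neg (by simp)]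
      rfl
  refine ⟨hT, fun n hn hn' => ?_, ?_⟩
  · obtain ⟨i, rfl⟩ := Nat.exists_eq_add_of_le hn
    rw [hwait i (by omega)]
  · rw [gameState, hwait _ le_rfl, gameStep, if_neg ho', hc'' _ (by omega), Function.update_self,
      if_pos rfl, show w + (k - w) = k by omega, hkd]

/-- A position from which player I can go on: `c` vanishes from `T` on and its first `T` bits decide
that at time `T` the moves made are those in `l`. -/
structure GoodPosition (a : (ℕ → Bool) → ℕ → Bool) (c₀ : ℕ → Bool) (n₀ : ℕ) (c : ℕ → Bool) (T : ℕ)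
    (l : List ℕ) : Prop where
  le : n₀ ≤ T
  agree : ∀ i < n₀, c i = c₀ i
  zero : ∀ i ≥ T, c i = false
  even : Even l.length
  state : ∀ c', (∀ i < T, c' i = c i) → (gameState (a c') c' T).1 = l

lemma GoodPosition.exists_next (ha : Continuous a) (hw : ∀ c, (v, a c, c) ∈ WinSet B)
    {c₀ : ℕ → Bool} {n₀ : ℕ} (h₀ : ∀ c, (∀ i < n₀, c i = c₀ i) →
      ∀ n ≥ n₀, 1 ≤ (gameState (a c) c n).1.length)
    {c : ℕ → Bool} {T : ℕ} {l : List ℕ} (h : GoodPosition a c₀ n₀ c T l) :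
    ∃ j, ∀ b, ∃ c' T', GoodPosition a c₀ n₀ c' T' (l ++ [j] ++ [b]) ∧ T < T' ∧
      (∀ i < T, c' i = c i) ∧ ∀ c'', (∀ i < T', c'' i = c' i) → ∀ n, T ≤ n → n < T' →
        (gameState (a c'') c'' n).1 <+: (gameState (a c'') c'' (n + 1)).1 := by
  have hl := h.state c fun _ _ => rfl
  obtain ⟨T₁, hT₁, j, hj, hj'⟩ := exists_move (hw c) (T := T)
    (fun n hn => h₀ c h.agree n (h.le.trans hn)) (hl ▸ h.even)
  rw [hl] at hj hj'
  have ho : Odd (l ++ [j]).length := by simpa using h.even.add_one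
  refine ⟨j, fun b => ?_⟩
  obtain ⟨c', T', hT', hc', h0, hst⟩ := exists_declare ha (T := T₁)
    (fun i hi => h.zero i (by omega)) (hj' ▸ ho) (b + 1)
  rw [hj'] at hst
  have hle := h.le
  refine ⟨c', T', ⟨by omega, fun i hi => ?_, h0, ?_, fun c'' hc'' => ?_⟩, by omega,
    fun i hi => hc' i (by omega), fun c'' hc'' n hn hn' => ?_⟩
  · rw [hc' i (by omega), h.agree i hi]
  · rw [List.length_append]
    exact ho.add_one
  · rw [(hst c'' hc'').2.2, declare]
  · obtain ⟨h1, h2, h3⟩ := hst c'' hc''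
    rcases lt_trichotomy (n + 1) T₁ with hlt | rfl | hlt
    · rw [h1 _ (by omega), h1 _ (by omega), hj n hn (by omega), hj _ (by omega) hlt]
    · rw [h1 _ (by omega), hj n hn (by omega), h1 _ le_rfl, hj']
      exact List.prefix_append _ _
    · rw [h2 n (by omega) hn']
      rcases eq_or_lt_of_le (Nat.succ_le_of_lt hn') with rfl | hlt'
      · rw [h3, declare]
        exact List.prefix_append _ _
      · rw [h2 (n + 1) (by omega) hlt']

lemma exists_goodPosition (ha : Continuous a) (hw : ∀ c, (v, a c, c) ∈ WinSet B)
    {c₀ : ℕ → Bool} {n₀ : ℕ} (h₀ : ∀ c, (∀ i < n₀, c i = c₀ i) →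
      ∀ n ≥ n₀, 1 ≤ (gameState (a c) c n).1.length) :
    ∃ c T l, GoodPosition a c₀ n₀ c T l ∧ l.length = 2 := by
  set c : ℕ → Bool := fun i => decide (i < n₀) && c₀ i
  have hc : ∀ i < n₀, c i = c₀ i := fun i hi => by simp [c, hi]
  have hz : ∀ i ≥ n₀, c i = false := fun i hi => by simp [c, hi]
  have h1 := h₀ c hc
  obtain ⟨T, hT, ho⟩ : ∃ T ≥ n₀, Odd (gameState (a c) c T).1.length := by
    by_cases he : Even (gameState (a c) c n₀).1.length
    · obtain ⟨T, hT, j, -, hj⟩ := exists_move (hw c) h1 he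
      exact ⟨T, hT.le, by rw [hj]; simpa using he.add_one⟩
    · exact ⟨n₀, le_rfl, Nat.not_even_iff_odd.1 he⟩
  obtain ⟨c₁, T₁, hT₁, hc₁, hz₁, hs₁⟩ :=
    exists_declare ha (T := T) (fun i hi => hz i (by omega)) ho 0
  have hl₁ : (gameState (a c₁) c₁ T₁).1.length = 1 := by
    rw [(hs₁ c₁ fun _ _ => rfl).2.2, declare, if_neg (Nat.not_even_iff_odd.2 ho)]
    simp only [List.length_take]
    have := ho.pos
    omega
  obtain ⟨c₂, T₂, hT₂, hc₂, hz₂, hs₂⟩ :=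
    exists_declare ha (T := T₁) hz₁ (hl₁ ▸ odd_one) 1
  refine ⟨c₂, T₂, (gameState (a c₁) c₁ T₁).1 ++ [0], ⟨by omega, fun i hi => ?_, hz₂, ?_,
    fun c' hc' => ?_⟩, by simp [hl₁]⟩
  · rw [hc₂ i (by omega), hc₁ i (by omega), hc i hi]
  · simp [hl₁]
  · rw [(hs₂ c' hc').2.2, declare]

/-- If all the runs of the asynchronous game in which player I replies continuously are won by
player I, then he wins the game. -/
lemma playerIWins_of_continuous (ha : Continuous a) (hw : ∀ c, (v, a c, c) ∈ WinSet B) :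
    PlayerIWins {γ | (v, γ) ∈ B} := by
  obtain ⟨c₀, n₀, h₀⟩ := exists_forall_one_le ha hw
  obtain ⟨cs, Ts, ls, hs, hls⟩ := exists_goodPosition ha hw h₀
  let P := {p : (ℕ → Bool) × ℕ × List ℕ // GoodPosition a c₀ n₀ p.1 p.2.1 p.2.2}
  have hnext : ∀ p : P, ∃ j, ∀ b, ∃ p' : P, p'.1.2.2 = p.1.2.2 ++ [j] ++ [b] ∧
      p.1.2.1 < p'.1.2.1 ∧ (∀ i < p.1.2.1, p'.1.1 i = p.1.1 i) ∧
      ∀ c, (∀ i < p'.1.2.1, c i = p'.1.1 i) → ∀ n, p.1.2.1 ≤ n → n < p'.1.2.1 →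
        (gameState (a c) c n).1 <+: (gameState (a c) c (n + 1)).1 := fun p => by
    obtain ⟨j, hj⟩ := p.2.exists_next ha hw h₀
    refine ⟨j, fun b => ?_⟩
    obtain ⟨c', T', hg, h1, h2, h3⟩ := hj b
    exact ⟨⟨(c', T', _), hg⟩, rfl, h1, h2, h3⟩
  choose move next hlist hlt hagree hpre using hnext
  refine ⟨fun s => move (s.foldl next ⟨(cs, Ts, ls), hs⟩), fun β => ?_⟩
  set γ := playI (fun s => move (s.foldl next ⟨(cs, Ts, ls), hs⟩)) β with hγ
  set q : ℕ → P := fun k => (List.ofFn fun i : Fin k => β i).foldl next ⟨(cs, Ts, ls), hs⟩ with hq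
  have hq_succ : ∀ k, q (k + 1) = next (q k) (β k) := fun k => by
    simp only [hq]
    rw [List.ofFn_succ', List.concat_eq_append, List.foldl_append]
    rfl
  have hγ_even : ∀ k, γ (2 * k) = move (q k) := fun k => by
    simp [hγ, playI, hq]
  have hγ_odd : ∀ k, γ (2 * k + 1) = β k := fun k => by
    rw [hγ, playI, if_neg (by omega), show (2 * k + 1) / 2 = k by omega]
  have hql : ∀ k, (q k).1.2.2 = ls ++ (List.range (2 * k)).map γ := by
    intro k
    induction k with
    | zero => simp [hq]
    | succ k ih =>
      rw [hq_succ, hlist, ih, show 2 * (k + 1) = 2 * k + 1 + 1 by ring, List.range_succ,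
        List.range_succ]
      simp [hγ_even, hγ_odd]
  have hT : StrictMono fun k => (q k).1.2.1 :=
    strictMono_nat_of_lt_succ fun k => by rw [hq_succ]; exact hlt _ _
  have hTk : ∀ k, k ≤ (q k).1.2.1 := fun _ => hT.le_apply
  have hag : ∀ k m, k ≤ m → ∀ i < (q k).1.2.1, (q m).1.1 i = (q k).1.1 i := by
    intro k m hkm i hi
    induction m, hkm using Nat.le_induction with
    | base => rfl
    | succ m hm ih =>
      rw [hq_succ, hagree _ _ i (hi.trans_le (hT.monotone hm)), ih]
  set c : ℕ → Bool := fun i => (q (i + 1)).1.1 i with hc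
  have hcq : ∀ k, ∀ i < (q k).1.2.1, c i = (q k).1.1 i := by
    intro k i hi
    rcases le_total k (i + 1) with h | h
    · exact hag _ _ h i hi
    · exact (hag _ _ h i (hTk (i + 1))).symm
  have hstate : ∀ k, (gameState (a c) c (q k).1.2.1).1 = ls ++ (List.range (2 * k)).map γ :=
    fun k => ((q k).2.state c (hcq k)).trans (hql k)
  have hmono : ∀ n ≥ (q 0).1.2.1, (gameState (a c) c n).1 <+: (gameState (a c) c (n + 1)).1 := by
    intro n hn
    obtain ⟨k, hk, hk'⟩ : ∃ k, (q k).1.2.1 ≤ n ∧ n < (q (k + 1)).1.2.1 := by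
      by_contra! hcon
      have : ∀ k, (q k).1.2.1 ≤ n := fun k => Nat.rec hn hcon k
      have := (hTk (n + 1)).trans (this (n + 1))
      omega
    rw [hq_succ] at hk'
    refine hpre _ _ c (fun i hi => ?_) n hk hk'
    rw [hcq (k + 1) i (by rwa [hq_succ]), hq_succ]
  rcases hw c with ⟨K, -, -, hK⟩ | ⟨M, γ', -, hγ', hB⟩
  · exfalso
    obtain ⟨n, hn, hnK⟩ := hK (q (K + 1)).1.2.1
    have := (isPrefix_of_forall_succ hmono (hT.monotone (Nat.zero_le _)) hn).length_le
    rw [hstate, hnK] at this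
    simp at this
    omega
  · change (v, γ) ∈ B
    convert hB using 2
    funext i
    have hk : M ≤ (q (M + i + 1)).1.2.1 := le_trans (by omega) (hTk _)
    refine (hγ' _ hk i _ ?_).symm
    rw [hstate, List.getElem?_append_right (by omega), hls, List.getElem?_map,
      List.getElem?_range (by omega)]
    simp

end ContinuousReply

/-- The dyadic rationals. -/
def dyadics : Set ℝ := {t | ∃ n : ℕ, ∃ k : ℤ, 2 ^ n * t = k}

/-- The binary digits of a real number in `[0, 1)`. -/
noncomputable def bits (t : ℝ) (n : ℕ) : Bool := decide (Odd ⌊2 ^ (n + 1) * t⌋)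

/-- The integer with the binary digits `a 0, …, a (n - 1)`. -/
def binNum (a : ℕ → Bool) : ℕ → ℤ
  | 0 => 0
  | n + 1 => 2 * binNum a n + if a n then 1 else 0

/-- The real number with the binary digits `a 0, a 1, …`. -/
noncomputable def binReal (a : ℕ → Bool) : ℝ := ⨆ n, (binNum a n : ℝ) / 2 ^ n

lemma binNum_congr {a b : ℕ → Bool} {n : ℕ} (h : ∀ i < n, a i = b i) : binNum a n = binNum b n := by
  induction n with
  | zero => rfl
  | succ n ih => rw [binNum, binNum, ih fun i hi => h i (by omega), h n (by omega)]

lemma isLocallyConstant_binNum (n : ℕ) : IsLocallyConstant fun a => binNum a n := by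
  induction n with
  | zero => exact IsLocallyConstant.const _
  | succ n ih =>
    exact (ih.prodMk (isLocallyConstant_apply n)).comp fun q => 2 * q.1 + if q.2 then 1 else 0

lemma monotone_binNum_div (a : ℕ → Bool) : Monotone fun n => (binNum a n : ℝ) / 2 ^ n := by
  refine monotone_nat_of_le_succ fun n => ?_
  rw [div_le_div_iff₀ (by positivity) (by positivity), binNum, pow_succ]
  have : (0 : ℝ) < 2 ^ n := by positivity
  split_ifs <;> push_cast <;> nlinarith

lemma antitone_binNum_add_one_div (a : ℕ → Bool) :
    Antitone fun n => ((binNum a n : ℝ) + 1) / 2 ^ n := by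
  refine antitone_nat_of_succ_le fun n => ?_
  rw [div_le_div_iff₀ (by positivity) (by positivity), binNum, pow_succ]
  have : (0 : ℝ) < 2 ^ n := by positivity
  split_ifs <;> push_cast <;> nlinarith

lemma binNum_div_le_add_one_div (a : ℕ → Bool) (m n : ℕ) :
    (binNum a m : ℝ) / 2 ^ m ≤ ((binNum a n : ℝ) + 1) / 2 ^ n :=
  calc (binNum a m : ℝ) / 2 ^ m ≤ (binNum a (max m n) : ℝ) / 2 ^ (max m n) :=
        monotone_binNum_div a (le_max_left m n)
    _ ≤ ((binNum a (max m n) : ℝ) + 1) / 2 ^ (max m n) := by gcongr; simp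
    _ ≤ _ := antitone_binNum_add_one_div a (le_max_right m n)

lemma binNum_div_le (a : ℕ → Bool) (n : ℕ) : (binNum a n : ℝ) / 2 ^ n ≤ binReal a :=
  le_ciSup (f := fun n => (binNum a n : ℝ) / 2 ^ n)
    ⟨_, forall_mem_range.2 fun m => binNum_div_le_add_one_div a m 0⟩ n

lemma binReal_le (a : ℕ → Bool) (n : ℕ) : binReal a ≤ ((binNum a n : ℝ) + 1) / 2 ^ n :=
  ciSup_le fun m => binNum_div_le_add_one_div a m n

lemma binReal_mem_Icc (a : ℕ → Bool) : binReal a ∈ Icc (0 : ℝ) 1 := by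
  constructor
  · simpa [binNum] using binNum_div_le a 0
  · simpa [binNum] using binReal_le a 0

lemma continuous_binReal : Continuous binReal := by
  refine continuous_iff_continuousAt.2 fun a => Metric.tendsto_nhds.2 fun ε hε => ?_
  obtain ⟨n, hn⟩ := exists_pow_lt_of_lt_one hε (show (1 / 2 : ℝ) < 1 by norm_num)
  filter_upwards [(isLocallyConstant_binNum n).eventually_eq a] with b hb
  have h1 := binNum_div_le a n
  have h2 := binNum_div_le b n
  have h3 := binReal_le a n
  have h4 := binReal_le b n
  rw [hb] at h2 h4
  rw [add_div] at h3 h4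
  rw [div_pow, one_pow] at hn
  rw [Real.dist_eq, abs_lt]
  constructor <;> linarith

lemma floor_binReal {a : ℕ → Bool} (h : binReal a ∉ dyadics) (n : ℕ) :
    ⌊2 ^ n * binReal a⌋ = binNum a n := by
  have h1 := binNum_div_le a n
  have h2 := binReal_le a n
  rw [div_le_iff₀' (by positivity)] at h1
  rw [le_div_iff₀' (by positivity)] at h2
  refine Int.floor_eq_iff.2 ⟨h1, lt_of_le_of_ne h2 fun heq => h ⟨n, binNum a n + 1, ?_⟩⟩
  rw [heq]
  push_cast
  rfl

lemma bits_binReal {a : ℕ → Bool} (h : binReal a ∉ dyadics) : bits (binReal a) = a := by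
  funext n
  rw [bits, floor_binReal h, binNum]
  cases h : a n <;> simp

lemma binReal_notMem_dyadics {a : ℕ → Bool} {N : ℕ} (h : ∀ n ≥ N, a (2 * n + 1) = !a (2 * n)) :
    binReal a ∉ dyadics := by
  rintro ⟨m, z, hz⟩
  set n := max N m
  have hn := h n (le_max_left _ _)
  obtain ⟨d, hd⟩ : ∃ d, 2 * n = m + d := ⟨2 * n - m, by have := le_max_right N m; omega⟩
  have h1 := binNum_div_le a (2 * n + 1 + 1)
  have h2 := binReal_le a (2 * n + 1 + 1)
  have h3 : (2 : ℝ) ^ (2 * n + 1 + 1) * binReal a = ((4 * (2 ^ d * z) : ℤ) : ℝ) := by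
    push_cast
    rw [← hz, hd]
    ring
  rw [div_le_iff₀' (by positivity), h3, Int.cast_le] at h1
  rw [le_div_iff₀' (by positivity), h3] at h2
  have h2' : 4 * (2 ^ d * z) ≤ binNum a (2 * n + 1 + 1) + 1 := by exact_mod_cast h2
  rw [binNum, binNum, hn] at h1 h2'
  generalize 2 ^ d * z = y at h1 h2'
  generalize a (2 * n) = b at h1 h2'
  cases b <;> simp at h1 h2' <;> omega

lemma binNum_bits {t : ℝ} (h0 : 0 ≤ t) (h1 : t < 1) (n : ℕ) : binNum (bits t) n = ⌊2 ^ n * t⌋ := by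
  induction n with
  | zero =>
    rw [binNum, pow_zero, one_mul]
    exact (Int.floor_eq_zero_iff.2 ⟨h0, h1⟩).symm
  | succ n ih =>
    rw [binNum, ih, bits]
    have h2 := Int.floor_le (2 ^ n * t)
    have h3 := Int.lt_floor_add_one (2 ^ n * t)
    generalize ⌊2 ^ n * t⌋ = k at h2 h3
    have h4 : 2 * k ≤ ⌊2 ^ (n + 1) * t⌋ := by
      rw [Int.le_floor, pow_succ]
      push_cast
      linarith
    have h5 : ⌊2 ^ (n + 1) * t⌋ < 2 * k + 2 := by
      rw [Int.floor_lt, pow_succ]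
      push_cast
      linarith
    generalize ⌊2 ^ (n + 1) * t⌋ = j at h4 h5
    rcases (by omega : j = 2 * k ∨ j = 2 * k + 1) with rfl | rfl <;> simp

lemma eventually_bits_eq {t : ℝ} (ht : t ∉ dyadics) (n : ℕ) : ∀ᶠ s in 𝓝 t, bits s n = bits t n := by
  have h1 : (⌊2 ^ (n + 1) * t⌋ : ℝ) < 2 ^ (n + 1) * t :=
    lt_of_le_of_ne (Int.floor_le _) fun h => ht ⟨n + 1, _, h.symm⟩
  have h2 := Int.lt_floor_add_one (2 ^ (n + 1) * t)
  have hc : ContinuousAt (fun s : ℝ => 2 ^ (n + 1) * s) t := by fun_prop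
  filter_upwards [hc.eventually_mem (Ioo_mem_nhds h1 h2)] with s hs
  rw [bits, bits, Int.floor_eq_iff.2 ⟨hs.1.le, hs.2⟩]

lemma div_two_pow_mem_dyadics (k : ℤ) (n : ℕ) : (k : ℝ) / 2 ^ n ∈ dyadics :=
  ⟨n, k, by field_simp⟩

lemma countable_dyadics : dyadics.Countable := by
  have : dyadics = ⋃ n : ℕ, ⋃ k : ℤ, {(k : ℝ) / 2 ^ n} := by
    ext t
    simp only [dyadics, mem_ofPred_eq, mem_iUnion, mem_singleton_iff]
    refine exists_congr fun n => exists_congr fun k => ?_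
    rw [eq_div_iff (by positivity), mul_comm]
  rw [this]
  exact countable_iUnion fun n => countable_iUnion fun k => countable_singleton _

/-- If player I wins the game, any interval contains the graph of a continuous function avoiding
the space under consideration. -/
lemma exists_continuous_cut {B : Set ((ℕ → Bool) × (ℕ → ℕ))} {v : ℕ → Bool}
    (h : PlayerIWins {γ | (v, γ) ∈ B}) {p q : ℝ} (hp : 0 ≤ p) (hpq : p < q) (hq : q ≤ 1) :
    ∃ g : (ℕ → Bool) → ℝ, Continuous g ∧ ∀ c, p < g c ∧ g c < q ∧ g c ∉ dyadics ∧
      (v, bits (g c), c) ∈ WinSet B := by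
  obtain ⟨N, hN⟩ := exists_pow_lt_of_lt_one (show 0 < (q - p) / 2 by linarith)
    (show (1 / 2 : ℝ) < 1 by norm_num)
  obtain ⟨a, ha, hac⟩ := exists_continuous_reply h (bits ((p + q) / 2)) N
  refine ⟨fun c => binReal (a c), continuous_binReal.comp ha, fun c => ?_⟩
  obtain ⟨h1, h2, h3⟩ := hac c
  have hd := binReal_notMem_dyadics h2
  have hk : binNum (a c) N = ⌊2 ^ N * ((p + q) / 2)⌋ := by
    rw [← binNum_bits (by linarith) (by linarith)]
    exact binNum_congr fun i hi => h1 i (by omega)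
  have h4 := binNum_div_le (a c) N
  have h5 := binReal_le (a c) N
  have h6 := Int.floor_le (2 ^ N * ((p + q) / 2))
  have h7 := Int.lt_floor_add_one (2 ^ N * ((p + q) / 2))
  rw [← hk] at h6 h7
  rw [← div_le_iff₀' (by positivity)] at h6
  rw [← lt_div_iff₀' (by positivity), add_div (binNum (a c) N : ℝ)] at h7
  rw [add_div] at h5
  rw [div_pow, one_pow] at hN
  exact ⟨by linarith, by linarith, hd, by rwa [bits_binReal hd]⟩

/-- A second countable space with a base of clopen sets is zero-dimensional. -/
lemma dimLE_zero_of_isClopen {T : Type*} [TopologicalSpace T] [SecondCountableTopology T]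
    (h : ∀ x : T, ∀ U, IsOpen U → x ∈ U → ∃ V, IsClopen V ∧ x ∈ V ∧ V ⊆ U) : DimLE T 0 := by
  intro k U hU hcov
  have : ∀ x, ∃ i, ∃ V, IsClopen V ∧ x ∈ V ∧ V ⊆ U i := fun x => by
    obtain ⟨i, hi⟩ := mem_iUnion.1 (hcov ▸ mem_univ x)
    exact ⟨i, h x (U i) (hU i) hi⟩
  choose i V hV hxV hVU using this
  rcases isEmpty_or_nonempty T with hT | ⟨⟨x₀⟩⟩
  · exact ⟨U, hU, fun _ => le_rfl, hcov, fun x => (hT.false x).elim⟩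
  obtain ⟨s, hs, hsV⟩ := TopologicalSpace.countable_cover_nhds fun x => (hV x).isOpen.mem_nhds (hxV x)
  have hne : s.Nonempty := by
    by_contra hne
    rw [not_nonempty_iff_eq_empty.1 hne] at hsV
    simp at hsV
    exact (eq_empty_iff_forall_notMem.1 hsV.symm) x₀ (mem_univ _)
  obtain ⟨f, rfl⟩ := hs.exists_eq_range hne
  rw [biUnion_range] at hsV
  classical
  have hex : ∀ x, ∃ n, x ∈ V (f n) := fun x => mem_iUnion.1 (hsV ▸ mem_univ x)
  have hopen : ∀ n, IsOpen {x | Nat.find (hex x) = n} := by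
    intro n
    have : {x | Nat.find (hex x) = n} = V (f n) ∩ ⋂ m ∈ Iio n, (V (f m))ᶜ := by
      ext x
      simp [Nat.find_eq_iff]
    rw [this]
    exact (hV _).isOpen.inter ((finite_Iio n).isOpen_biInter fun m _ => (hV _).compl.isOpen)
  refine ⟨fun j => ⋃ n : {n // i (f n) = j}, {x | Nat.find (hex x) = n},
    fun j => isOpen_iUnion fun n => hopen n, fun j x hx => ?_, eq_univ_of_forall fun x => ?_,
    fun x => ?_⟩
  · obtain ⟨⟨n, rfl⟩, hn⟩ := mem_iUnion.1 hx
    change Nat.find (hex x) = n at hn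
    exact hVU _ (hn ▸ Nat.find_spec (hex x))
  · exact mem_iUnion.2 ⟨i (f (Nat.find (hex x))), mem_iUnion.2 ⟨⟨_, rfl⟩, rfl⟩⟩
  · refine (ncard_le_one_iff).2 fun {j j'} hj hj' => ?_
    obtain ⟨⟨n, rfl⟩, hn⟩ := mem_iUnion.1 hj
    obtain ⟨⟨n', rfl⟩, hn'⟩ := mem_iUnion.1 hj'
    change Nat.find (hex x) = n at hn
    change Nat.find (hex x) = n' at hn'
    rw [← hn, ← hn']

lemma DimLE.of_homeomorph {S T : Type*} [TopologicalSpace S] [TopologicalSpace T] {n : ℕ}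
    (h : DimLE S n) (e : S ≃ₜ T) : DimLE T n := by
  intro k U hU hcov
  obtain ⟨V, hV, hVU, hVcov, hcard⟩ := h k (fun i => e ⁻¹' U i) (fun i => (hU i).preimage e.continuous)
    (by rw [← preimage_iUnion, hcov, preimage_univ])
  refine ⟨fun i => e.symm ⁻¹' V i, fun i => (hV i).preimage e.symm.continuous, fun i x hx => ?_,
    by rw [← preimage_iUnion, hVcov, preimage_univ], fun x => hcard (e.symm x)⟩
  simpa using hVU i hx

/-- The part of `2^ω × [0, 1]` that is zero-dimensional if and only if player I wins the game. -/
def slice (B : Set ((ℕ → Bool) × (ℕ → ℕ))) (v : ℕ → Bool) : Set ((ℕ → Bool) × ℝ) :=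
  {p | p.2 ∈ Icc 0 1 ∧ (p.2 ∈ dyadics ∨ (v, bits p.2, p.1) ∉ WinSet B)}

lemma dimLE_slice {B : Set ((ℕ → Bool) × (ℕ → ℕ))} {v : ℕ → Bool}
    (h : PlayerIWins {γ | (v, γ) ∈ B}) : DimLE (slice B v) 0 := by
  have hcut : ∀ g : (ℕ → Bool) → ℝ, Continuous g →
      (∀ c, g c ∉ dyadics ∧ (v, bits (g c), c) ∈ WinSet B) →
      IsClopen {y : slice B v | g y.1.1 < y.1.2} ∧ IsClopen {y : slice B v | y.1.2 < g y.1.1} := by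
    intro g hg hgc
    have hc1 : Continuous fun y : slice B v => g y.1.1 := by fun_prop
    have hc2 : Continuous fun y : slice B v => y.1.2 := by fun_prop
    have hne : ∀ y : slice B v, g y.1.1 ≠ y.1.2 := fun y hy => by
      rcases y.2.2 with h1 | h1
      · exact (hgc y.1.1).1 (hy ▸ h1)
      · exact h1 (hy ▸ (hgc y.1.1).2)
    refine ⟨⟨?_, isOpen_lt hc1 hc2⟩, ⟨?_, isOpen_lt hc2 hc1⟩⟩
    · convert isClosed_le hc1 hc2 using 1
      ext y
      exact (hne y).le_iff_lt.symm
    · convert isClosed_le hc2 hc1 using 1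
      ext y
      exact (hne y).symm.le_iff_lt.symm
  refine dimLE_zero_of_isClopen fun y U hU hy => ?_
  obtain ⟨O, hO, rfl⟩ := isOpen_induced_iff.1 hU
  obtain ⟨U₁, hU₁, U₂, hU₂, hsub⟩ := mem_nhds_prod_iff.1 (hO.mem_nhds hy)
  obtain ⟨m, hm⟩ := exists_forall_agree_mem hU₁
  obtain ⟨ε, hε, hball⟩ := Metric.mem_nhds_iff.1 hU₂
  have ⟨h0, h1⟩ := y.2.1
  obtain ⟨L, hL, hyL, hLε⟩ : ∃ L : Set (slice B v), IsClopen L ∧ y ∈ L ∧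
      ∀ x ∈ L, y.1.2 - ε < x.1.2 := by
    rcases h0.eq_or_lt with h0 | h0
    · exact ⟨univ, isClopen_univ, mem_univ _, fun x _ => by have := x.2.1.1; linarith⟩
    · obtain ⟨g, hg, hgc⟩ := exists_continuous_cut h (p := max 0 (y.1.2 - ε)) (q := y.1.2)
        (le_max_left _ _) (max_lt h0 (by linarith)) h1
      exact ⟨_, (hcut g hg fun c => (hgc c).2.2).1, (hgc _).2.1, fun x hx =>
        (le_max_right _ _).trans_lt ((hgc _).1.trans hx)⟩
  obtain ⟨R, hR, hyR, hRε⟩ : ∃ R : Set (slice B v), IsClopen R ∧ y ∈ R ∧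
      ∀ x ∈ R, x.1.2 < y.1.2 + ε := by
    rcases h1.eq_or_lt with h1 | h1
    · exact ⟨univ, isClopen_univ, mem_univ _, fun x _ => by have := x.2.1.2; linarith⟩
    · obtain ⟨g, hg, hgc⟩ := exists_continuous_cut h (p := y.1.2) (q := min 1 (y.1.2 + ε))
        h0 (lt_min h1 (by linarith)) (min_le_left _ _)
      exact ⟨_, (hcut g hg fun c => (hgc c).2.2).2, (hgc _).1, fun x (hx : x.1.2 < _) =>
        (hx.trans (hgc _).2.1).trans_le (min_le_right _ _)⟩
  have hC : IsClopen {x : slice B v | ∀ i ∈ Iio m, x.1.1 i = y.1.1 i} := by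
    simp only [ofPred_forall]
    exact (finite_Iio m).isClopen_biInter fun i _ =>
      ((isLocallyConstant_apply i).comp_continuous (f := fun x : slice B v => x.1.1)
        (by fun_prop)).isClopen_setOf fun b => b = y.1.1 i
  refine ⟨_, (hL.inter hR).inter hC, ⟨⟨hyL, hyR⟩, fun i _ => rfl⟩, fun x hx => hsub ⟨?_, hball ?_⟩⟩
  · exact hm _ hx.2
  · rw [Real.ball_eq_Ioo]
    exact ⟨hLε x hx.1.1, hRε x hx.1.2⟩

lemma IsLocallyConstant.apply_dep {W S T : Type*} [TopologicalSpace W] {f : W → S} {g : S → W → T}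
    (hf : IsLocallyConstant f) (hg : ∀ s, IsLocallyConstant (g s)) :
    IsLocallyConstant fun x => g (f x) x := by
  refine (IsLocallyConstant.iff_eventually_eq _).2 fun x => ?_
  filter_upwards [hf.eventually_eq x, (hg (f x)).eventually_eq x] with y h1 h2
  rw [h1, h2]

/-- Binary search: at each stage one descends to the half-interval at whose left endpoint `S` holds
and at whose right endpoint it fails. -/
def searchNum (S : ℕ → ℤ → Bool) : ℕ → ℤ
  | 0 => 0
  | n + 1 => 2 * searchNum S n + if S (n + 1) (2 * searchNum S n + 1) then 1 else 0

lemma binNum_search (S : ℕ → ℤ → Bool) (n : ℕ) :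
    binNum (fun n => S (n + 1) (2 * searchNum S n + 1)) n = searchNum S n := by
  induction n with
  | zero => rfl
  | succ n ih => rw [binNum, searchNum, ih]

lemma searchNum_spec {S : ℕ → ℤ → Bool} (h0 : S 0 0 = true) (h1 : S 0 1 = false)
    (hS : ∀ n k, S (n + 1) (2 * k) = S n k) (n : ℕ) :
    0 ≤ searchNum S n ∧ searchNum S n < 2 ^ n ∧ S n (searchNum S n) = true ∧
      S n (searchNum S n + 1) = false := by
  induction n with
  | zero => simpa [searchNum, h0] using h1
  | succ n ih =>
    obtain ⟨h2, h3, h4, h5⟩ := ih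
    rw [searchNum, pow_succ]
    split_ifs with h
    · refine ⟨by omega, by omega, h, ?_⟩
      rw [← h5, ← hS n]
      exact congrArg (S (n + 1)) (by ring)
    · exact ⟨by omega, by omega, by rw [add_zero, hS, h4], by simpa using h⟩

lemma playerIWins_of_dimLE_slice {B : Set ((ℕ → Bool) × (ℕ → ℕ))} {v : ℕ → Bool}
    (h : DimLE (slice B v) 0) : PlayerIWins {γ | (v, γ) ∈ B} := by
  classical
  obtain ⟨V, hV, hVU, hcov, hcard⟩ := h 2 ![{y | y.1.2 < 1}, {y | 0 < y.1.2}]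
    (by
      have : Continuous fun y : slice B v => y.1.2 := by fun_prop
      simp [Fin.forall_fin_two, isOpen_lt this continuous_const, isOpen_lt continuous_const this])
    (by
      refine eq_univ_of_forall fun y => mem_iUnion.2 ?_
      simp only [Fin.exists_fin_two]
      rcases lt_or_ge y.1.2 1 with h | h
      · exact .inl h
      · exact .inr (zero_lt_one.trans_le h))
  have hcover : ∀ y, y ∈ V 0 ∨ y ∈ V 1 := fun y => by
    have := mem_iUnion.1 (hcov ▸ mem_univ y)
    rwa [Fin.exists_fin_two] at this
  have hdisj : ∀ y, y ∈ V 0 → y ∉ V 1 := fun y h0 h1 => by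
    simpa using (ncard_le_one (toFinite _)).1 (hcard y) 0 h0 1 h1
  let S : (ℕ → Bool) → ℕ → ℤ → Bool := fun c n k =>
    decide (∃ h : (c, (k : ℝ) / 2 ^ n) ∈ slice B v, ⟨_, h⟩ ∈ V 0)
  have hmem : ∀ (c : ℕ → Bool) (n : ℕ) (k : ℤ), 0 ≤ k → k ≤ 2 ^ n →
      (c, (k : ℝ) / 2 ^ n) ∈ slice B v := fun c n k h0 h1 => by
    refine ⟨⟨by have : (0 : ℝ) ≤ k := (by exact_mod_cast h0); positivity,
      (div_le_one (by positivity)).2 (by exact_mod_cast h1)⟩, .inl (div_two_pow_mem_dyadics k n)⟩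
  have hSloc : ∀ n k, IsLocallyConstant fun c => S c n k := by
    intro n k
    by_cases hk : 0 ≤ k ∧ k ≤ 2 ^ n
    · have hm := fun c => hmem c n k hk.1 hk.2
      have hc : Continuous fun c => (⟨_, hm c⟩ : slice B v) := by fun_prop
      refine (IsLocallyConstant.iff_eventually_eq _).2 fun c => ?_
      have hS : ∀ c, S c n k = decide ((⟨_, hm c⟩ : slice B v) ∈ V 0) := fun c => by
        simp only [S]
        exact decide_eq_decide.2 ⟨fun ⟨_, h⟩ => h, fun h => ⟨hm c, h⟩⟩
      simp only [hS]
      rcases hcover ⟨_, hm c⟩ with h | h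
      · filter_upwards [hc.continuousAt.eventually_mem ((hV 0).mem_nhds h)] with c' hc'
        simp [h, hc']
      · filter_upwards [hc.continuousAt.eventually_mem ((hV 1).mem_nhds h)] with c' hc'
        have h1 := fun h' => hdisj _ h' h
        have h2 := fun h' => hdisj _ h' hc'
        exact decide_eq_decide.2 (iff_of_false h2 h1)
    · refine IsLocallyConstant.iff_exists_open _ |>.2 fun c => ⟨univ, isOpen_univ, mem_univ _,
        fun c' _ => ?_⟩
      have : ∀ c, S c n k = false := fun c => by
        simp only [S, decide_eq_false_iff_not]
        rintro ⟨h, -⟩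
        refine hk ⟨?_, ?_⟩
        · have := h.1.1
          rw [le_div_iff₀ (by positivity), zero_mul] at this
          exact_mod_cast this
        · have := h.1.2
          rw [div_le_iff₀ (by positivity), one_mul] at this
          exact_mod_cast this
      rw [this, this]
  have hnumloc : ∀ n, IsLocallyConstant fun c => searchNum (S c) n := by
    intro n
    induction n with
    | zero => exact IsLocallyConstant.const _
    | succ n ih =>
      exact ih.apply_dep (g := fun k c => 2 * k + if S c (n + 1) (2 * k + 1) then 1 else 0)
        fun k => (hSloc (n + 1) (2 * k + 1)).comp fun b => 2 * k + if b then 1 else 0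
  have hspec : ∀ c n, 0 ≤ searchNum (S c) n ∧ searchNum (S c) n < 2 ^ n ∧
      S c n (searchNum (S c) n) = true ∧ S c n (searchNum (S c) n + 1) = false := by
    intro c n
    refine searchNum_spec ?_ ?_ (fun n k => ?_) n
    · have h0 := hmem c 0 0 le_rfl (by norm_num)
      simp only [S, decide_eq_true_eq]
      refine ⟨h0, (hcover _).resolve_right fun h => ?_⟩
      simpa using hVU 1 h
    · simp only [S, decide_eq_false_iff_not]
      rintro ⟨h0, h⟩
      simpa using hVU 0 h
    · have : ((2 * k : ℤ) : ℝ) / 2 ^ (n + 1) = k / 2 ^ n := by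
        push_cast
        rw [pow_succ]
        field_simp
      simp only [S, this]
  set a : (ℕ → Bool) → ℕ → Bool := fun c n => S c (n + 1) (2 * searchNum (S c) n + 1) with ha
  refine playerIWins_of_continuous (a := a) (continuous_pi fun n => ?_) fun c => ?_
  · exact ((hnumloc n).apply_dep (g := fun k c => S c (n + 1) (2 * k + 1))
      fun k => hSloc _ _).continuous
  have hnum : ∀ n, binNum (a c) n = searchNum (S c) n := binNum_search _
  have hnot : (c, binReal (a c)) ∉ slice B v := by
    intro hc
    have key : ∀ i, ⟨_, hc⟩ ∈ V i → ∃ n, ∀ k : ℤ, |(k : ℝ) / 2 ^ n - binReal (a c)| ≤ 1 / 2 ^ n →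
        ∀ h : (c, (k : ℝ) / 2 ^ n) ∈ slice B v, ⟨_, h⟩ ∈ V i := by
      intro i hi
      obtain ⟨O, hO, hOV⟩ := isOpen_induced_iff.1 (hV i)
      have hcont : Continuous fun t : ℝ => (c, t) := by fun_prop
      have hmemO : (c, binReal (a c)) ∈ O := by
        change (⟨_, hc⟩ : slice B v) ∈ Subtype.val ⁻¹' O
        rwa [hOV]
      obtain ⟨ε, hε, hball⟩ := Metric.mem_nhds_iff.1
        (hcont.continuousAt.preimage_mem_nhds (hO.mem_nhds hmemO))
      obtain ⟨n, hn⟩ := exists_pow_lt_of_lt_one hε (show (1 / 2 : ℝ) < 1 by norm_num)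
      rw [div_pow, one_pow] at hn
      refine ⟨n, fun k hk h => ?_⟩
      rw [← hOV]
      exact hball (by rw [Metric.mem_ball, Real.dist_eq]; exact hk.trans_lt hn)
    rcases hcover ⟨_, hc⟩ with h | h
    · obtain ⟨n, hn⟩ := key 0 h
      obtain ⟨h1, h2, h3, h4⟩ := hspec c n
      have h5 := binNum_div_le (a c) n
      have h6 := binReal_le (a c) n
      rw [hnum, add_div] at h6
      rw [hnum] at h5
      have hm := hmem c n (searchNum (S c) n + 1) (by omega) (by omega)
      have := hn (searchNum (S c) n + 1) (by
        push_cast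
        rw [abs_le, add_div]
        constructor <;> linarith) hm
      simp only [S, decide_eq_false_iff_not] at h4
      exact h4 ⟨hm, this⟩
    · obtain ⟨n, hn⟩ := key 1 h
      obtain ⟨h1, h2, h3, h4⟩ := hspec c n
      have h5 := binNum_div_le (a c) n
      have h6 := binReal_le (a c) n
      rw [hnum, add_div] at h6
      rw [hnum] at h5
      have hm := hmem c n (searchNum (S c) n) (by omega) (by omega)
      have := hn (searchNum (S c) n) (by
        rw [abs_le]
        constructor <;> linarith) hm
      simp only [S, decide_eq_true_eq] at h3
      obtain ⟨_, h3⟩ := h3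
      exact hdisj _ h3 this
  have hd : binReal (a c) ∉ dyadics := fun hd => hnot ⟨binReal_mem_Icc _, .inl hd⟩
  by_contra hw
  exact hnot ⟨binReal_mem_Icc _, .inr (by rwa [bits_binReal hd])⟩

lemma dimLE_slice_iff {B : Set ((ℕ → Bool) × (ℕ → ℕ))} {v : ℕ → Bool} :
    DimLE (slice B v) 0 ↔ PlayerIWins {γ | (v, γ) ∈ B} :=
  ⟨playerIWins_of_dimLE_slice, dimLE_slice⟩

/-- The even part of a sequence. -/
def evenPart (u : ℕ → Bool) : ℕ → Bool := fun n => u (2 * n)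

/-- The odd part of a sequence. -/
def oddPart (u : ℕ → Bool) : ℕ → Bool := fun n => u (2 * n + 1)

/-- The sequence with given even and odd parts. -/
def merge (w c : ℕ → Bool) : ℕ → Bool := fun i => if i % 2 = 0 then w (i / 2) else c (i / 2)

lemma continuous_evenPart : Continuous evenPart := continuous_pi fun _ => continuous_apply _

lemma continuous_oddPart : Continuous oddPart := continuous_pi fun _ => continuous_apply _

lemma continuous_merge : Continuous fun p : (ℕ → Bool) × (ℕ → Bool) => merge p.1 p.2 := by
  refine continuous_pi fun i => ?_
  unfold merge
  split_ifs <;> fun_prop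

@[simp] lemma evenPart_merge (w c : ℕ → Bool) : evenPart (merge w c) = w := by
  funext n
  simp [evenPart, merge]

@[simp] lemma oddPart_merge (w c : ℕ → Bool) : oddPart (merge w c) = c := by
  funext n
  rw [oddPart, merge, if_neg (by omega), show (2 * n + 1) / 2 = n by omega]

lemma merge_parts (u : ℕ → Bool) : merge (evenPart u) (oddPart u) = u := by
  funext i
  rw [merge, evenPart, oddPart]
  split_ifs with h
  · exact congrArg u (by omega)
  · exact congrArg u (by omega)

/-- The sequences with finitely many marks; `w` has a mark at `n` if `w (2 * n)` is true. -/
def finMarks : Set (ℕ → Bool) := {w | ∃ m, ∀ n ≥ m, w (2 * n) = false}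

/-- The sequence of bits following the marks. -/
noncomputable def decode (w : ℕ → Bool) (k : ℕ) : Bool := w (2 * Nat.nth (fun i => w (2 * i) = true) k + 1)

lemma isGδ_compl_finMarks : IsGδ finMarksᶜ := by
  have : finMarksᶜ = ⋂ m : ℕ, ⋃ n ≥ m, {w : ℕ → Bool | w (2 * n) = true} := by
    ext w
    simp [finMarks]
  rw [this]
  exact .iInter fun m => (isOpen_biUnion fun n _ =>
    ((isLocallyConstant_apply (2 * n)).isClopen_setOf fun b => b = true).isOpen).isGδ

lemma infinite_marks {w : ℕ → Bool} (hw : w ∉ finMarks) : {i | w (2 * i) = true}.Infinite := by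
  refine Set.infinite_of_forall_exists_gt fun m => ?_
  simp only [finMarks, mem_ofPred_eq, not_exists, not_forall] at hw
  obtain ⟨n, hn, h⟩ := hw (m + 1)
  exact ⟨n, by simpa using h, hn⟩

lemma eventually_decode_eq {w : ℕ → Bool} (hw : w ∉ finMarks) (k : ℕ) :
    ∀ᶠ w' in 𝓝 w, decode w' k = decode w k := by
  have hmark := Nat.nth_mem_of_infinite (infinite_marks hw) k
  have hcount := Nat.count_nth_of_infinite (infinite_marks hw) k
  change w _ = true at hmark
  rw [decode]
  generalize Nat.nth (fun i => w (2 * i) = true) k = n at hmark hcount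
  have hagree : ∀ᶠ w' in 𝓝 w, ∀ i ∈ Iio (2 * n + 2), w' i = w i :=
    (eventually_all_finite (finite_Iio _)).2 fun i _ => (isLocallyConstant_apply i).eventually_eq w
  filter_upwards [hagree] with w' hw'
  have hc : Nat.count (fun i => w' (2 * i) = true) n = k := by
    rw [← hcount, Nat.count_eq_card_filter_range, Nat.count_eq_card_filter_range]
    refine congrArg _ (Finset.filter_congr fun i hi => ?_)
    rw [hw' (2 * i) (by have := Finset.mem_range.1 hi; simp; omega)]
  have hn : Nat.nth (fun i => w' (2 * i) = true) k = n := by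
    rw [← hc]
    exact Nat.nth_count (p := fun i => w' (2 * i) = true)
      (by rw [hw' (2 * n) (by simp)]; exact hmark)
  rw [decode, hn, hw' _ (by simp)]

/-- The sequence with marks at the places `n k`, followed by the bits `v k`. -/
noncomputable def encode (n : ℕ → ℕ) (v : ℕ → Bool) (i : ℕ) : Bool :=
  open Classical in decide (∃ k, i = 2 * n k ∨ (i = 2 * n k + 1 ∧ v k = true))

lemma encode_even (n : ℕ → ℕ) (v : ℕ → Bool) (i : ℕ) :
    encode n v (2 * i) = true ↔ i ∈ range n := by
  simp only [encode, decide_eq_true_eq, mem_range]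
  exact exists_congr fun k => by omega

lemma encode_odd {n : ℕ → ℕ} (hn : StrictMono n) (v : ℕ → Bool) (k : ℕ) :
    encode n v (2 * n k + 1) = v k := by
  rw [Bool.eq_iff_iff]
  simp only [encode, decide_eq_true_eq]
  constructor
  · rintro ⟨j, h | ⟨h, hj⟩⟩
    · omega
    · rwa [← hn.injective (by omega : n j = n k)]
  · exact fun h => ⟨k, .inr ⟨rfl, h⟩⟩

lemma continuous_encode {n : ℕ → ℕ} (hn : StrictMono n) : Continuous (encode n) := by
  refine continuous_pi fun i => ?_
  by_cases h : ∃ k, i = 2 * n k + 1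
  · obtain ⟨k, rfl⟩ := h
    simp only [encode_odd hn]
    exact continuous_apply k
  · push Not at h
    have hconst (v : ℕ → Bool) : encode n v i = encode n (fun _ => false) i := by
      rw [Bool.eq_iff_iff]
      simp only [encode, decide_eq_true_eq]
      exact exists_congr fun k => by simp [h k]
    simp only [hconst]
    exact continuous_const

lemma encode_notMem_finMarks {n : ℕ → ℕ} (hn : StrictMono n) (v : ℕ → Bool) :
    encode n v ∉ finMarks := by
  rintro ⟨m, hm⟩
  have := hm (n m) hn.le_apply
  rw [← Bool.not_eq_true, encode_even] at this
  exact this (mem_range_self m)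

lemma decode_encode {n : ℕ → ℕ} (hn : StrictMono n) (v : ℕ → Bool) :
    decode (encode n v) = v := by
  have hinf := infinite_marks (encode_notMem_finMarks hn v)
  have : Nat.nth (fun i => encode n v (2 * i) = true) = n := by
    rw [← (Nat.nth_strictMono hinf).range_inj hn, Nat.range_nth_of_infinite hinf]
    ext i
    exact encode_even n v i
  funext k
  rw [decode, this, encode_odd hn]

/-- Cantor space can be encoded in any dense `Gδ` set containing `finMarks`. -/
lemma exists_encode {G : ℕ → Set (ℕ → Bool)} (hG : ∀ k, IsOpen (G k)) (hfin : ∀ k, finMarks ⊆ G k) :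
    ∃ n : ℕ → ℕ, StrictMono n ∧ ∀ v k, encode n v ∈ G k := by
  have hnext : ∀ k m, ∃ m' > m, ∀ w : ℕ → Bool, (∀ i, 2 * m + 2 ≤ i → i < 2 * m' → w i = false) →
      w ∈ G k := by
    intro k m
    obtain ⟨m', hm'⟩ := exists_subset_nhds_of_compactSpace
      (V := fun m' : ℕ => {w : ℕ → Bool | ∀ i, 2 * m + 2 ≤ i → i < 2 * m' → w i = false})
      (U := G k) (directed_of_isDirected_le fun a b hab w hw i hi hi' => hw i hi (by omega))
      (fun m' => by
        simp only [ofPred_forall]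
        exact isClosed_iInter fun i => isClosed_iInter fun _ => isClosed_iInter fun _ =>
          ((isLocallyConstant_apply i).isClopen_setOf fun b => b = false).isClosed)
      (fun w hw => (hG k).mem_nhds (hfin k ⟨m + 1, fun n hn =>
        (mem_iInter.1 hw (n + 1)) (2 * n) (by omega) (by omega)⟩))
    exact ⟨max (m + 1) m', lt_max_of_lt_left m.lt_succ_self, fun w hw =>
      hm' fun i hi hi' => hw i hi (hi'.trans_le (by omega))⟩
  choose next hlt hnext using hnext
  let n : ℕ → ℕ := fun k => Nat.rec 0 next k
  have hn : StrictMono n := strictMono_nat_of_lt_succ fun k => hlt k (n k)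
  refine ⟨n, hn, fun v k => hnext k (n k) _ fun i hi (hi' : i < 2 * n (k + 1)) => ?_⟩
  simp only [encode, decide_eq_false_iff_not]
  rintro ⟨j, hj⟩
  have h1 : n k < n j := by omega
  have h2 : n j < n (k + 1) := by omega
  have h3 : k < j := hn.lt_iff_lt.1 h1
  have h4 : j < k + 1 := hn.lt_iff_lt.1 h2
  omega

/-- A lower semicontinuous set-valued map which is continuous at the points of `Q`, where the
values are compact, is upper semicontinuous on a `Gδ` set containing `Q`. -/
lemma exists_isOpen_forall_upper {W Y : Type*} [TopologicalSpace W] [TopologicalSpace Y]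
    [CompactSpace Y] [MetrizableSpace Y] {E : W → Set Y} {Q : Set W}
    (hlow : ∀ U, IsOpen U → IsOpen {w | (E w ∩ U).Nonempty})
    (hcpt : ∀ w ∈ Q, IsCompact (E w))
    (hupp : ∀ w ∈ Q, ∀ U, IsOpen U → E w ⊆ U → ∀ᶠ w' in 𝓝 w, E w' ⊆ U) :
    ∃ G : ℕ → Set W, (∀ k, IsOpen (G k)) ∧ (∀ k, Q ⊆ G k) ∧ ∀ w, (∀ k, w ∈ G k) →
      ∀ U, IsOpen U → closure (E w) ⊆ U → ∀ᶠ w' in 𝓝 w, closure (E w') ⊆ U := by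
  let := metrizableSpaceMetric Y
  refine ⟨fun k => {w | ∃ N, IsOpen N ∧ w ∈ N ∧ ∀ w' ∈ N, ∀ w'' ∈ N,
    E w' ⊆ Metric.thickening (1 / ((k : ℝ) + 1)) (E w'')}, fun k => ?_, fun k w hw => ?_,
    fun w hw U hU hwU => ?_⟩
  · refine isOpen_iff_forall_mem_open.2 fun w ⟨N, hN, hwN, h⟩ => ⟨N, fun w' hw' => ?_, hN, hwN⟩
    exact ⟨N, hN, hw', h⟩
  · have hε : 0 < 1 / ((k : ℝ) + 1) := by positivity
    rw [mem_ofPred_eq]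
    generalize 1 / ((k : ℝ) + 1) = ε at hε ⊢
    have h1 := hupp w hw _ Metric.isOpen_thickening
      (Metric.self_subset_thickening (half_pos hε) (E w))
    obtain ⟨t, htE, htfin, ht⟩ := (hcpt w hw).finite_cover_balls (half_pos (half_pos hε))
    have h2 : ∀ᶠ w' in 𝓝 w, ∀ y ∈ t, (E w' ∩ Metric.ball y (ε / 2 / 2)).Nonempty :=
      (eventually_all_finite htfin).2 fun y hy => (hlow _ Metric.isOpen_ball).mem_nhds
        ⟨y, htE hy, Metric.mem_ball_self (by positivity)⟩
    obtain ⟨N, hNsub, hN, hwN⟩ := eventually_nhds_iff.1 (h1.and h2)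
    refine ⟨N, hN, hwN, fun w' hw' w'' hw'' x hx => ?_⟩
    obtain ⟨z, hz, hxz⟩ := Metric.mem_thickening_iff.1 ((hNsub w' hw').1 hx)
    obtain ⟨y, hy, hzy⟩ := mem_iUnion₂.1 (ht hz)
    obtain ⟨x', hx', hyx'⟩ := (hNsub w'' hw'').2 y hy
    refine Metric.mem_thickening_iff.2 ⟨x', hx', ?_⟩
    rw [Metric.mem_ball] at hzy hyx'
    have h3 := dist_triangle4 x z y x'
    rw [dist_comm y x'] at h3
    linarith
  · obtain ⟨δ, hδ, hsub⟩ := isClosed_closure.isCompact.exists_thickening_subset_open hU hwU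
    obtain ⟨k, hk⟩ := exists_nat_one_div_lt hδ
    obtain ⟨N, hN, hwN, h⟩ := hw k
    filter_upwards [hN.mem_nhds hwN] with w' hw'
    calc closure (E w') ⊆ closure (Metric.thickening (1 / ((k : ℝ) + 1)) (E w)) :=
          closure_mono (h w' hw' w hwN)
      _ ⊆ Metric.cthickening (1 / ((k : ℝ) + 1)) (E w) :=
          Metric.closure_thickening_subset_cthickening _ _
      _ ⊆ Metric.thickening δ (E w) := Metric.cthickening_subset_thickening' hδ hk _
      _ ⊆ Metric.thickening δ (closure (E w)) := Metric.thickening_subset_of_subset δ subset_closure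
      _ ⊆ U := hsub

/-- The sum of the slices of `B`, completed by the fibres over `finMarks` and over `dyadics`. -/
def sliceSum (B : Set ((ℕ → Bool) × (ℕ → ℕ))) : Set ((ℕ → Bool) × Icc (0 : ℝ) 1) :=
  {p | evenPart p.1 ∈ finMarks ∨ (p.2 : ℝ) ∈ dyadics ∨
    (decode (evenPart p.1), bits p.2, oddPart p.1) ∉ WinSet B}

lemma sigmaOrd_compl_sliceSum {ξ : Ordinal.{0}} (hξ : 3 ≤ ξ) {B : Set ((ℕ → Bool) × (ℕ → ℕ))}
    (hB : SigmaOrd ξ B) : SigmaOrd ξ (sliceSum B)ᶜ := by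
  let P : Set ((ℕ → Bool) × Icc (0 : ℝ) 1) :=
    (fun p => evenPart p.1) ⁻¹' finMarksᶜ ∩ (fun p => (p.2 : ℝ)) ⁻¹' dyadicsᶜ
  have hP : IsGδ P :=
    (isGδ_compl_finMarks.preimage (continuous_evenPart.comp continuous_fst)).inter
      (countable_dyadics.isGδ_compl.preimage (continuous_subtype_val.comp continuous_snd))
  let f : P → (ℕ → Bool) × (ℕ → Bool) × (ℕ → Bool) := fun p =>
    (decode (evenPart p.1.1), bits p.1.2, oddPart p.1.1)
  have hf : Continuous f := by
    refine .prodMk (continuous_pi fun k => ?_) (.prodMk (continuous_pi fun k => ?_) ?_)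
    · refine continuous_iff_continuousAt.2 fun p => ?_
      have hc : ContinuousAt (fun p : P => evenPart p.1.1) p :=
        (continuous_evenPart.comp (continuous_fst.comp continuous_subtype_val)).continuousAt
      exact (continuousAt_const (y := decode (evenPart p.1.1) k)).congr
        ((hc.eventually (eventually_decode_eq p.2.1 k)).mono fun _ h => h.symm)
    · refine continuous_iff_continuousAt.2 fun p => ?_
      have hc : ContinuousAt (fun p : P => (p.1.2 : ℝ)) p := by fun_prop
      exact (continuousAt_const (y := bits p.1.2 k)).congr
        ((hc.eventually (eventually_bits_eq p.2.2 k)).mono fun _ h => h.symm)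
    · exact continuous_oddPart.comp (continuous_fst.comp continuous_subtype_val)
  convert (sigmaOrd_winSet hξ hB).preimage_of_isGδ hξ hP hf using 1
  ext p
  simp only [sliceSum, mem_compl_iff, mem_ofPred_eq, not_or, not_not, P, f, mem_inter_iff,
    mem_preimage, exists_prop, and_assoc]

/-- The fibre of `sliceSum B` over `w`. -/
def fibre (B : Set ((ℕ → Bool) × (ℕ → ℕ))) (w : ℕ → Bool) : Set (sliceSum B) :=
  {x | evenPart x.1.1 = w}

lemma isClosed_fibre (B : Set ((ℕ → Bool) × (ℕ → ℕ))) (w : ℕ → Bool) : IsClosed (fibre B w) :=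
  isClosed_eq (continuous_evenPart.comp (continuous_fst.comp continuous_subtype_val))
    continuous_const

/-- The fibre over a sequence with infinitely many marks is a slice. -/
def fibreHomeomorph (B : Set ((ℕ → Bool) × (ℕ → ℕ))) {w : ℕ → Bool} (hw : w ∉ finMarks) :
    fibre B w ≃ₜ slice B (decode w) where
  toFun x := ⟨(oddPart x.1.1.1, x.1.1.2), x.1.1.2.2, by
    have h := x.1.2
    have hx : evenPart x.1.1.1 = w := x.2
    simp only [sliceSum, mem_ofPred_eq, hx] at h
    exact h.resolve_left hw⟩
  invFun y := ⟨⟨(merge w y.1.1, ⟨y.1.2, y.2.1⟩), by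
    simp only [sliceSum, mem_ofPred_eq, evenPart_merge, oddPart_merge]
    exact .inr y.2.2⟩, evenPart_merge _ _⟩
  left_inv x := by
    have hx : evenPart x.1.1.1 = w := x.2
    refine Subtype.ext (Subtype.ext (Prod.ext ?_ rfl))
    exact (congrArg (merge · _) hx.symm).trans (merge_parts _)
  right_inv y := Subtype.ext (Prod.ext (oddPart_merge _ _) rfl)
  continuous_toFun := by
    refine .subtype_mk (.prodMk ?_ (by fun_prop)) _
    exact continuous_oddPart.comp (by fun_prop)
  continuous_invFun := by
    refine .subtype_mk (.subtype_mk (.prodMk ?_ (by fun_prop)) _) _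
    exact continuous_merge.comp (f := fun y : slice B (decode w) => (w, y.1.1)) (by fun_prop)

lemma dimLE_fibre_iff {B : Set ((ℕ → Bool) × (ℕ → ℕ))} {w : ℕ → Bool} (hw : w ∉ finMarks) :
    DimLE (fibre B w) 0 ↔ PlayerIWins {γ | (decode w, γ) ∈ B} := by
  rw [← dimLE_slice_iff]
  exact ⟨fun h => h.of_homeomorph (fibreHomeomorph B hw),
    fun h => h.of_homeomorph (fibreHomeomorph B hw).symm⟩

lemma dense_dyadics_Icc : Dense {t : Icc (0 : ℝ) 1 | (t : ℝ) ∈ dyadics} := by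
  refine Metric.dense_iff.2 fun t r hr => ?_
  obtain ⟨n, hn⟩ := exists_pow_lt_of_lt_one hr (by norm_num : (1 / 2 : ℝ) < 1)
  have hpos : (0 : ℝ) < 2 ^ n := by positivity
  have h1 := Int.floor_le (2 ^ n * (t : ℝ))
  have h2 := Int.lt_floor_add_one (2 ^ n * (t : ℝ))
  have hle : (⌊2 ^ n * (t : ℝ)⌋ : ℝ) / 2 ^ n ≤ t := by
    rw [div_le_iff₀ hpos]
    linarith
  have hlt : (t : ℝ) < (⌊2 ^ n * (t : ℝ)⌋ : ℝ) / 2 ^ n + (1 / 2) ^ n := by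
    rw [one_div, inv_pow, ← one_div, ← add_div, lt_div_iff₀ hpos]
    linarith
  have h0 : 0 ≤ (⌊2 ^ n * (t : ℝ)⌋ : ℝ) / 2 ^ n := by
    have : 0 ≤ ⌊2 ^ n * (t : ℝ)⌋ := Int.floor_nonneg.2 (mul_nonneg hpos.le t.2.1)
    positivity
  refine ⟨⟨(⌊2 ^ n * (t : ℝ)⌋ : ℝ) / 2 ^ n, h0, hle.trans t.2.2⟩, ?_, div_two_pow_mem_dyadics _ _⟩
  rw [Metric.mem_ball, Subtype.dist_eq, Real.dist_eq, abs_lt]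
  constructor <;> simp only <;> linarith

lemma isOpen_fibre_inter_nonempty (B : Set ((ℕ → Bool) × (ℕ → ℕ))) {V : Set (sliceSum B)}
    (hV : IsOpen V) : IsOpen {w | (fibre B w ∩ V).Nonempty} := by
  obtain ⟨O, hO, rfl⟩ := isOpen_induced_iff.1 hV
  refine isOpen_iff_mem_nhds.2 fun w ⟨⟨⟨u, t⟩, hx⟩, (hxw : evenPart u = w), hxO⟩ => ?_
  obtain ⟨t', htO, ht'⟩ := dense_dyadics_Icc.inter_open_nonempty {t' | (u, t') ∈ O}
    (hO.preimage (by fun_prop)) ⟨t, hxO⟩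
  have hc : Continuous fun w' => (merge w' (oddPart u), t') :=
    (continuous_merge.comp (f := fun w' => (w', oddPart u)) (by fun_prop)).prodMk continuous_const
  have hmem : (merge w (oddPart u), t') ∈ O := by
    rw [← hxw, merge_parts]
    exact htO
  filter_upwards [(hO.preimage hc).mem_nhds hmem] with w' hw'
  exact ⟨⟨(merge w' (oddPart u), t'), .inr (.inl ht')⟩, evenPart_merge _ _, hw'⟩

lemma isCompact_fibre (B : Set ((ℕ → Bool) × (ℕ → ℕ))) {w : ℕ → Bool} (hw : w ∈ finMarks) :
    IsCompact (fibre B w) := by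
  have hmem : ∀ p : (ℕ → Bool) × Icc (0 : ℝ) 1, (merge w p.1, p.2) ∈ sliceSum B := fun p =>
    .inl (by simpa using hw)
  have hc : Continuous fun p : (ℕ → Bool) × Icc (0 : ℝ) 1 => (⟨_, hmem p⟩ : sliceSum B) :=
    .subtype_mk ((continuous_merge.comp
      (f := fun p : (ℕ → Bool) × Icc (0 : ℝ) 1 => (w, p.1)) (by fun_prop)).prodMk continuous_snd) _
  convert isCompact_range hc
  ext x
  refine ⟨fun (hx : evenPart x.1.1 = w) => ⟨(oddPart x.1.1, x.1.2), Subtype.ext (Prod.ext ?_ rfl)⟩, ?_⟩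
  · change merge w (oddPart x.1.1) = x.1.1
    rw [← hx, merge_parts]
  · rintro ⟨p, rfl⟩
    exact evenPart_merge _ _

lemma eventually_fibre_subset (B : Set ((ℕ → Bool) × (ℕ → ℕ))) {w : ℕ → Bool} (hw : w ∈ finMarks)
    {V : Set (sliceSum B)} (hV : IsOpen V) (hwV : fibre B w ⊆ V) :
    ∀ᶠ w' in 𝓝 w, fibre B w' ⊆ V := by
  obtain ⟨O, hO, rfl⟩ := isOpen_induced_iff.1 hV
  have hc : Continuous fun q : (ℕ → Bool) × (ℕ → Bool) × Icc (0 : ℝ) 1 =>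
      (merge q.1 q.2.1, q.2.2) :=
    (continuous_merge.comp (f := fun q : (ℕ → Bool) × (ℕ → Bool) × Icc (0 : ℝ) 1 => (q.1, q.2.1))
      (by fun_prop)).prodMk (by fun_prop)
  have := (isCompact_univ (X := (ℕ → Bool) × Icc (0 : ℝ) 1)).eventually_forall_of_forall_eventually
    (x₀ := w) (P := fun w' p => (merge w' p.1, p.2) ∈ O) fun p _ => by
      have hmem : (merge w p.1, p.2) ∈ sliceSum B := .inl (by simpa using hw)
      have hwO : (merge w p.1, p.2) ∈ O :=
        hwV (show (⟨_, hmem⟩ : sliceSum B) ∈ fibre B w from evenPart_merge _ _)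
      exact (hO.preimage hc).mem_nhds hwO
  filter_upwards [this] with w' hw' x hx
  have hx' : evenPart x.1.1 = w' := hx
  have := hw' (oddPart x.1.1, x.1.2) trivial
  rw [← hx'] at this
  simp only [merge_parts] at this
  exact this

/-- For every admissible topology, the fibres over suitable codes depend continuously on the
coded sequence. -/
lemma exists_continuous_fibre_encode (B : Set ((ℕ → Bool) × (ℕ → ℕ)))
    {τ : TopologicalSpace (Cl (sliceSum B))} (hτ : IsAdmissible (sliceSum B) τ) :
    ∃ n : ℕ → ℕ, StrictMono n ∧
      Continuous[_, τ] fun v => (⟨fibre B (encode n v), isClosed_fibre B _⟩ : Cl (sliceSum B)) := by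
  obtain ⟨Y, tY, hY, hY', e, he, rfl⟩ := hτ
  obtain ⟨G, hG, hQG, hup⟩ := exists_isOpen_forall_upper (E := fun w => e '' fibre B w)
    (Q := finMarks) (fun U hU => by
      simp only [image_inter_nonempty_iff]
      exact isOpen_fibre_inter_nonempty B (hU.preimage he.continuous))
    (fun w hw => (isCompact_fibre B hw).image he.continuous)
    (fun w hw U hU hwU => by
      simp only [image_subset_iff] at hwU ⊢
      exact eventually_fibre_subset B hw (hU.preimage he.continuous) hwU)
  obtain ⟨n, hn, hnG⟩ := exists_encode hG hQG
  refine ⟨n, hn, continuous_induced_rng.2 (continuous_generateFrom_iff.2 ?_)⟩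
  rintro S (⟨U, hU, rfl⟩ | ⟨U, hU, rfl⟩)
  · refine isOpen_iff_mem_nhds.2 fun v hv => ?_
    exact (continuous_encode hn).continuousAt.eventually
      (hup (encode n v) (hnG v) U hU hv)
  · have : IsOpen {v | (fibre B (encode n v) ∩ e ⁻¹' U).Nonempty} :=
      (isOpen_fibre_inter_nonempty B (hU.preimage he.continuous)).preimage (continuous_encode hn)
    convert this using 1
    ext v
    change (closure (e '' fibre B (encode n v)) ∩ U).Nonempty ↔ _
    rw [closure_inter_open_nonempty_iff hU, image_inter_nonempty_iff]
    rfl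

/-- For every countable ordinal `ξ ≥ 3` there exists a `Π⁰ξ` set `X ⊆ 2^ω × [0,1]`
such that `F₀(X)` is `Game Σ⁰ξ`-hard. -/
theorem exists_PiXi_set_F0_gameSigmaXi_hard (ξ : Ordinal.{0})
    (hcount : ξ.card ≤ Cardinal.aleph0) (hξ : 3 ≤ ξ) :
    ∃ X : Set ((ℕ → Bool) × (Set.Icc (0:ℝ) 1)),
      SigmaOrd ξ Xᶜ ∧
      ∀ τ : TopologicalSpace (Cl ↥X), IsAdmissible (↥X) τ →
        @GameSigmaHard ξ _ τ (F0 ↥X) := by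
  obtain ⟨U, hU, huniv⟩ := exists_universal_sigmaOrd ((ℕ → Bool) × (ℕ → ℕ)) ξ hcount
    (le_trans (by norm_num) hξ)
  let B₀ : Set ((ℕ → Bool) × (ℕ → ℕ)) :=
    (fun p => (evenPart p.1, oddPart p.1, p.2)) ⁻¹' U
  have hB₀ : SigmaOrd ξ B₀ := hU.preimage
    ((continuous_evenPart.comp continuous_fst).prodMk
      ((continuous_oddPart.comp continuous_fst).prodMk continuous_snd))
  refine ⟨sliceSum B₀, sigmaOrd_compl_sliceSum hξ hB₀, fun τ hτ A' ⟨B, hB, hA'⟩ => ?_⟩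
  obtain ⟨n, hn, hcont⟩ := exists_continuous_fibre_encode B₀ hτ
  obtain ⟨e, rfl⟩ := huniv B hB
  refine ⟨fun x => ⟨fibre B₀ (encode n (merge e x)), isClosed_fibre B₀ _⟩,
    hcont.comp (continuous_merge.comp (f := fun x => (e, x)) (by fun_prop)), ?_⟩
  ext x
  change _ ↔ DimLE (fibre B₀ (encode n (merge e x))) 0
  rw [hA', dimLE_fibre_iff (encode_notMem_finMarks hn _), decode_encode hn]
  simp only [GameOp, mem_ofPred_eq, B₀, mem_preimage, evenPart_merge, oddPart_merge]
end
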